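/- Let α₁ and α₂ be multiplicatively independent rational numbers greater than 0 whose logarithms log α₁, log α₂ are real, let b₁, b₂ be positive integers, and let A₁, A₂ be real numbers greater than 1 such that log A_i ≥ max{ log H(α_i), |log α_i|, 1 } for i = 1, 2, where H(a/b) = max{|a|, |b|} for a rational a/b in lowest terms. Set b' = b₁/log A₂ + b₂/log A₁ and Λ = b₂·log α₂ − b₁·log α₁. Then log |Λ| ≥ −25.2 · (max{ log b' + 0.38, 10 })² · log A₁ · log A₂. -/

import Mathlib

theorem exists_det_ne_zero {ι P F : Type*} [Fintype ι] [DecidableEq ι] [Field F]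
    (v : P → ι → F) (hv : ∀ c : ι → F, (∀ p, ∑ i, c i * v p i = 0) → c = 0) :
    ∃ f : ι → P, (Matrix.of fun i j => v (f j) i).det ≠ 0 := by
  have hspan : Submodule.span F (Set.range v) = ⊤ := by
    by_contra hne
    obtain ⟨φ, hφ0, hφ⟩ := Submodule.exists_le_ker_of_lt_top _ (lt_top_iff_ne_top.2 hne)
    apply hφ0
    have hrep : ∀ x : ι → F, φ x = ∑ i, φ (Pi.single i 1) * x i := by
      intro x
      conv_lhs => rw [← Finset.univ_sum_single x]
      rw [map_sum]
      refine Finset.sum_congr rfl fun i _ => ?_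
      have : (Pi.single i (x i) : ι → F) = x i • Pi.single i 1 := by
        rw [← Pi.single_smul]; simp
      rw [this, map_smul, smul_eq_mul, mul_comm]
    have hc := hv (fun i => φ (Pi.single i 1)) (fun p => by
      rw [← hrep]
      exact hφ (Submodule.subset_span ⟨p, rfl⟩))
    ext1 i
    ext
    simpa using congrFun hc i
  obtain ⟨κ, a, -, hs, hli⟩ := exists_linearIndependent' F v
  rw [hspan] at hs
  let b := Module.Basis.mk hli hs.ge
  let e : ι ≃ κ := (Pi.basisFun F ι).indexEquiv b
  refine ⟨a ∘ e, ?_⟩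
  have h2 : LinearIndependent F (fun j => v (a (e j))) := hli.comp e e.injective
  have h3 : IsUnit (Matrix.of fun j i => v (a (e j)) i) :=
    Matrix.linearIndependent_rows_iff_isUnit.1 h2
  have h4 := (Matrix.isUnit_iff_isUnit_det _).1 h3
  rw [← Matrix.det_transpose]
  exact h4.ne_zero

section

open Polynomial

theorem coeff_prod_sum_of_natDegree_le {ι R : Type*} [CommSemiring R] (s : Finset ι)
    (f : ι → R[X]) (d : ι → ℕ) (hf : ∀ i ∈ s, (f i).natDegree ≤ d i) :
    (∏ i ∈ s, f i).coeff (∑ i ∈ s, d i) = ∏ i ∈ s, (f i).coeff (d i) := by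
  classical
  induction s using Finset.induction_on with
  | empty => simp
  | insert a s ha ih =>
    rw [Finset.prod_insert ha, Finset.sum_insert ha, Finset.prod_insert ha,
      coeff_mul_add_eq_of_natDegree_le (hf a (by simp)), ih fun i hi => hf i (by simp [hi])]
    exact (natDegree_prod_le _ _).trans (Finset.sum_le_sum fun i hi => hf i (by simp [hi]))

theorem natDegree_det_le_sum {ι R : Type*} [Fintype ι] [DecidableEq ι] [CommRing R]
    (M : Matrix ι ι R[X]) (d : ι → ℕ) (hM : ∀ i j, (M i j).natDegree ≤ d j) :
    M.det.natDegree ≤ ∑ j, d j := by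
  rw [Matrix.det_apply]
  refine natDegree_sum_le_of_forall_le _ _ fun σ _ => ?_
  refine (natDegree_smul_le _ _).trans ?_
  exact (natDegree_prod_le _ _).trans (Finset.sum_le_sum fun i _ => hM _ _)

theorem coeff_det_sum {ι R : Type*} [Fintype ι] [DecidableEq ι] [CommRing R]
    (M : Matrix ι ι R[X]) (d : ι → ℕ) (hM : ∀ i j, (M i j).natDegree ≤ d j) :
    M.det.coeff (∑ j, d j) = (Matrix.of fun i j => (M i j).coeff (d j)).det := by
  rw [Matrix.det_apply, Matrix.det_apply, finsetSum_coeff]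
  refine Finset.sum_congr rfl fun σ _ => ?_
  rw [coeff_smul, coeff_prod_sum_of_natDegree_le _ _ _ fun i _ => hM _ _]
  rfl

/-- A Nesterenko-type zero estimate for exponential polynomials `∑ Q_l(z) e^{(l-c)y}` on `ℝ × ℝ`:
vanishing on a sumset forces all coefficients to vanish. -/
theorem zero_estimate {n L : ℕ} (Q : Fin L → ℝ[X]) (hQ : ∀ l, (Q l).natDegree ≤ n)
    (c : ℝ) (β γ : Fin L → ℝ) (hγ : Function.Injective γ) (Z : Finset ℝ) (y : ℝ → ℝ)
    (hZ : n * L < Z.card)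
    (h : ∀ i, ∀ z ∈ Z, ∑ l, (Q l).eval (z + β i) * Real.exp (((l : ℕ) - c) * (y z + γ i)) = 0) :
    ∀ l, Q l = 0 := by
  classical
  by_contra! hne
  obtain ⟨l₀, hl₀⟩ := hne
  let J := {l : Fin L // Q l ≠ 0}
  have h' : ∀ i, ∀ z ∈ Z, ∑ l : J, (Q l).eval (z + β i) * Real.exp (((l : Fin L) : ℕ) * γ i) *
      Real.exp (((l : Fin L) : ℕ) * y z) = 0 := by
    intro i z hz
    have h1 := h i z hz
    have h2 : ∑ l, (Q l).eval (z + β i) * Real.exp (((l : Fin L) : ℕ) * γ i) *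
        Real.exp (((l : Fin L) : ℕ) * y z) = 0 := by
      rw [← mul_left_inj' (Real.exp_pos (-c * (y z + γ i))).ne', zero_mul, Finset.sum_mul, ← h1]
      refine Finset.sum_congr rfl fun l _ => ?_
      rw [mul_assoc, mul_assoc, ← Real.exp_add, ← Real.exp_add]
      congr 2; ring
    rw [← h2, ← Finset.sum_filter_of_ne (p := fun l => Q l ≠ 0)]
    · exact (Finset.sum_subtype _ (by simp) fun l : Fin L => (Q l).eval (z + β i) *
        Real.exp ((l : ℕ) * γ i) * Real.exp ((l : ℕ) * y z)).symm
    · rintro l - hl h0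
      simp [h0] at hl
  obtain ⟨f, hf⟩ := exists_det_ne_zero (ι := J) (P := Fin L)
    (fun i l => Real.exp (((l : Fin L) : ℕ) * γ i)) (fun a ha => by
      let p : ℝ[X] := ∑ l : J, C (a l) * X ^ ((l : Fin L) : ℕ)
      have hp : p = 0 := by
        refine eq_zero_of_natDegree_lt_card_of_eval_eq_zero p
          (f := fun i => Real.exp (γ i)) (Real.exp_injective.comp hγ) ?_ ?_
        · intro i
          rw [← ha i]
          simp only [p, eval_finsetSum, eval_mul, eval_C, eval_pow, eval_X]
          refine Finset.sum_congr rfl fun l _ => ?_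
          rw [← Real.exp_nat_mul]
        · rw [Fintype.card_fin]
          refine lt_of_le_of_lt (b := L - 1) (natDegree_sum_le_of_forall_le _ _ fun l _ => ?_) ?_
          · refine (natDegree_C_mul_X_pow_le _ _).trans ?_
            have := (l : Fin L).2
            omega
          · have := l₀.2
            omega
      funext l
      have h1 : p.coeff ((l : Fin L) : ℕ) = a l := by
        simp only [p, finsetSum_coeff, coeff_C_mul, coeff_X_pow]
        rw [Finset.sum_eq_single l]
        · simp
        · intro b _ hb
          rw [if_neg, mul_zero]
          intro hbl
          exact hb (Subtype.ext (Fin.ext hbl.symm))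
        · simp
      rw [← h1, hp]; simp)
  let M : Matrix J J ℝ[X] := Matrix.of fun i l =>
    (Q l).comp (X + C (β (f i))) * C (Real.exp (((l : Fin L) : ℕ) * γ (f i)))
  have hM : ∀ i j, (M i j).natDegree ≤ (Q j).natDegree := by
    intro i j
    refine (natDegree_mul_C_le _ _).trans ?_
    have := natDegree_comp (p := Q j) (q := X + C (β (f i)))
    rw [natDegree_X_add_C, mul_one] at this
    exact this.le
  have hdet : M.det = 0 := by
    refine eq_zero_of_natDegree_lt_card_of_eval_eq_zero' M.det Z ?_ ?_
    · intro z hz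
      rw [← coe_evalRingHom, RingHom.map_det]
      apply Matrix.exists_mulVec_eq_zero_iff.1
      refine ⟨fun l => Real.exp (((l : Fin L) : ℕ) * y z), ?_, ?_⟩
      · intro h0
        exact (Real.exp_pos _).ne' (congrFun h0 ⟨l₀, hl₀⟩)
      · funext i
        rw [Pi.zero_apply, ← h' (f i) z hz, Matrix.mulVec, dotProduct]
        refine Finset.sum_congr rfl fun l _ => ?_
        simp [M, Matrix.map_apply]
    · refine (natDegree_det_le_sum M _ hM).trans_lt (lt_of_le_of_lt ?_ hZ)
      refine (Finset.sum_le_card_nsmul _ _ n fun (l : J) _ => hQ l).trans ?_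
      rw [smul_eq_mul, mul_comm]
      refine Nat.mul_le_mul_left _ ?_
      exact (Fintype.card_subtype_le (fun l : Fin L => Q l ≠ 0)).trans (by rw [Fintype.card_fin])
  have hco := coeff_det_sum M _ hM
  rw [hdet, coeff_zero] at hco
  have h3 : (Matrix.of fun i j => (M i j).coeff (Q (j : Fin L)).natDegree) =
      Matrix.of fun i j : J => (Q j).leadingCoeff *
        (Matrix.of fun i j : J => Real.exp (((i : Fin L) : ℕ) * γ (f j))).transpose i j := by
    ext i j
    simp only [M, Matrix.of_apply, Matrix.transpose_apply, coeff_mul_C]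
    congr 1
    have := natDegree_comp (p := Q j) (q := X + C (β (f i)))
    rw [natDegree_X_add_C, mul_one] at this
    rw [← this, ← leadingCoeff, leadingCoeff_comp (by simp)]
    simp
  rw [h3, Matrix.det_mul_row, eq_comm, mul_eq_zero] at hco
  rcases hco with h4 | h4
  · obtain ⟨l, -, hl⟩ := Finset.prod_eq_zero_iff.1 h4
    exact l.2 (leadingCoeff_eq_zero.1 hl)
  · apply hf
    rwa [Matrix.det_transpose] at h4

end

section

open Polynomial

/-- The entry of the interpolation matrix at the row `(k, l)` and the point `(r, s)`: the value of
`z ^ k * exp ((l - c) * y)` at `z = r β + s β' - η`, `y = r x + s x' - y₀`. -/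
noncomputable def interpEntry {K L : ℕ} (β β' η x x' y₀ c : ℝ) (i : Fin K × Fin L) (p : ℕ × ℕ) : ℝ :=
  (p.1 * β + p.2 * β' - η) ^ (i.1 : ℕ) *
    Real.exp (((i.2 : ℕ) - c) * (p.1 * x + p.2 * x' - y₀))

theorem exists_interp_det_ne_zero {K L R₁ S₁ R₂ S₂ : ℕ} (hK : 0 < K)
    (β β' η x x' y₀ c : ℝ)
    (hx : Function.Injective fun p : ℕ × ℕ => (p.1 * x + p.2 * x' : ℝ))
    (hβ : Set.InjOn (fun p : ℕ × ℕ => (p.1 * β + p.2 * β' : ℝ))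
      (Finset.range R₂ ×ˢ Finset.range S₂ : Finset (ℕ × ℕ)))
    (h₁ : L ≤ R₁ * S₁) (h₂ : (K - 1) * L < R₂ * S₂) :
    ∃ pt : Fin K × Fin L → ℕ × ℕ,
      (∀ i, (pt i).1 < R₁ + R₂ - 1 ∧ (pt i).2 < S₁ + S₂ - 1) ∧
      (Matrix.of fun i j => interpEntry β β' η x x' y₀ c i (pt j)).det ≠ 0 := by
  classical
  obtain ⟨f, hf⟩ := exists_det_ne_zero (ι := Fin K × Fin L)
    (P := {p : ℕ × ℕ // p.1 < R₁ + R₂ - 1 ∧ p.2 < S₁ + S₂ - 1})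
    (fun p i => interpEntry β β' η x x' y₀ c i p) (fun a ha => by
      let Q : Fin L → ℝ[X] := fun l => ∑ k : Fin K, C (a (k, l)) * X ^ (k : ℕ)
      have hQ : ∀ l, (Q l).natDegree ≤ K - 1 := fun l =>
        natDegree_sum_le_of_forall_le _ _ fun k _ =>
          (natDegree_C_mul_X_pow_le _ _).trans (by have := k.2; omega)
      have hcard : Fintype.card (Fin L) ≤ Fintype.card (Fin R₁ × Fin S₁) := by simpa using h₁
      obtain ⟨e⟩ := Function.Embedding.nonempty_of_card_le hcard
      let Z : Finset ℝ := (Finset.range R₂ ×ˢ Finset.range S₂).image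
        fun p : ℕ × ℕ => (p.1 * β + p.2 * β' : ℝ)
      have hZc : Z.card = R₂ * S₂ := by
        rw [Finset.card_image_of_injOn hβ]; simp
      have hch : ∀ z : ℝ, ∃ p : ℕ × ℕ, z ∈ Z → (p.1 < R₂ ∧ p.2 < S₂) ∧
          (p.1 * β + p.2 * β' : ℝ) = z := by
        intro z
        by_cases hz : z ∈ Z
        · obtain ⟨p, hp, rfl⟩ := Finset.mem_image.1 hz
          exact ⟨p, fun _ => ⟨by simpa using hp, rfl⟩⟩
        · exact ⟨0, fun h => absurd h hz⟩
      choose q hq using hch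
      have hzero := zero_estimate Q hQ c
        (fun i => ((e i).1 : ℕ) * β + ((e i).2 : ℕ) * β' - η)
        (fun i => ((e i).1 : ℕ) * x + ((e i).2 : ℕ) * x' - y₀) (by
          intro i j hij
          have h1 : ((((e i).1 : ℕ), ((e i).2 : ℕ)) : ℕ × ℕ) = (((e j).1 : ℕ), ((e j).2 : ℕ)) :=
            hx (by simpa using hij)
          rw [Prod.mk.injEq] at h1
          exact e.injective (Prod.ext (Fin.ext h1.1) (Fin.ext h1.2)))
        Z (fun z => (q z).1 * x + (q z).2 * x') (by rwa [hZc]) (by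
          intro i z hz
          obtain ⟨⟨hq1, hq2⟩, hqz⟩ := hq z hz
          have h1 := ha ⟨((e i).1 + (q z).1, (e i).2 + (q z).2), by
            have h3 := (e i).1.2
            have h4 := (e i).2.2
            dsimp only
            omega⟩
          rw [← h1, Fintype.sum_prod_type_right]
          refine Finset.sum_congr rfl fun l _ => ?_
          simp only [Q, eval_finsetSum, eval_mul, eval_C, eval_pow, eval_X, interpEntry]
          rw [Finset.sum_mul]
          refine Finset.sum_congr rfl fun k _ => ?_
          rw [mul_assoc]
          congr 2
          · congr 1; push_cast; linear_combination -hqz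
          · congr 1; push_cast; ring)
      funext ⟨k, l⟩
      have h1 : (Q l).coeff (k : ℕ) = a (k, l) := by
        simp only [Q, finsetSum_coeff, coeff_C_mul, coeff_X_pow]
        rw [Finset.sum_eq_single k]
        · simp
        · intro b _ hb
          rw [if_neg, mul_zero]
          exact fun h => hb (Fin.ext h.symm)
        · simp
      rw [← h1, hzero]; simp)
  exact ⟨fun i => f i, fun i => (f i).2, hf⟩

end

theorem Differentiable.exists_eq_sum_add_pow_mul {f : ℂ → ℂ} (hf : Differentiable ℂ f) (T : ℕ) :
    ∃ (c : ℕ → ℂ) (g : ℂ → ℂ), Differentiable ℂ g ∧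
      ∀ z, f z = ∑ a ∈ Finset.range T, c a * z ^ a + z ^ T * g z := by
  induction T with
  | zero => exact ⟨0, f, hf, by simp⟩
  | succ T ih =>
    obtain ⟨c, g, hg, h⟩ := ih
    refine ⟨Function.update c T (g 0), dslope g 0, ?_, fun z => ?_⟩
    · rw [← differentiableOn_univ] at hg ⊢
      exact (Complex.differentiableOn_dslope Filter.univ_mem).2 hg
    · rw [Finset.sum_range_succ, Function.update_self, h z]
      have h1 : ∑ a ∈ Finset.range T, Function.update c T (g 0) a * z ^ a =
          ∑ a ∈ Finset.range T, c a * z ^ a := by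
        refine Finset.sum_congr rfl fun a ha => ?_
        rw [Function.update_of_ne (Finset.mem_range.1 ha).ne]
      have h2 := sub_smul_dslope g 0 z
      rw [sub_zero, smul_eq_mul] at h2
      rw [h1, pow_succ, mul_assoc, h2]
      ring

/-- The ring of entire functions. -/
def entireFunctions : Subring (ℂ → ℂ) where
  carrier := {f | Differentiable ℂ f}
  mul_mem' hf hg := Differentiable.mul hf hg
  one_mem' := differentiable_const 1
  add_mem' hf hg := Differentiable.add hf hg
  zero_mem' := differentiable_const 0
  neg_mem' hf := Differentiable.neg hf

theorem Matrix.det_congr_mod {R ι : Type*} [CommRing R] [Fintype ι] [DecidableEq ι]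
    (A B : Matrix ι ι R) (x : R) (h : ∀ i j, x ∣ A i j - B i j) : x ∣ A.det - B.det := by
  rw [← Ideal.mem_span_singleton, ← Ideal.Quotient.mk_eq_mk_iff_sub_mem, RingHom.map_det,
    RingHom.map_det]
  congr 1
  ext i j
  simp only [RingHom.mapMatrix_apply, Matrix.map_apply]
  rw [Ideal.Quotient.mk_eq_mk_iff_sub_mem, Ideal.mem_span_singleton]
  exact h i j

theorem Matrix.dvd_det_mul_of_injective {R ι W : Type*} [CommRing R] [Fintype ι] [DecidableEq ι]
    [Fintype W] (A : Matrix ι W R) (B : Matrix W ι R) (x : R)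
    (h : ∀ f : ι → W, Function.Injective f → x ∣ ∏ i, A i (f i)) : x ∣ (A * B).det := by
  classical
  have h1 : (A * B) = fun i => ∑ w, A i w • B w := by
    ext i j
    simp [Matrix.mul_apply]
  have h2 : (A * B).det = ∑ f : ι → W, (∏ i, A i (f i)) *
      Matrix.detRowAlternating (R := R) fun i => B (f i) := by
    have h3 := (Matrix.detRowAlternating (n := ι) (R := R)).toMultilinearMap.map_sum
      fun i w => A i w • B w
    simp only [MultilinearMap.map_smul_univ, smul_eq_mul] at h3
    rw [h1]
    exact h3
  rw [h2]
  refine Finset.dvd_sum fun f _ => ?_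
  by_cases hf : Function.Injective f
  · exact Dvd.dvd.mul_right (h f hf) _
  · have h3 : Matrix.detRowAlternating (fun i => B (f i)) = 0 :=
      AlternatingMap.map_eq_zero_of_not_injective _ (fun i => B (f i))
        fun hinj => hf (Function.Injective.of_comp (f := B) hinj)
    rw [h3, mul_zero]
    exact dvd_zero _

theorem exists_det_eq_pow_mul {ι : Type*} [Fintype ι] [DecidableEq ι] (f₁ f₂ : ι → ℂ → ℂ)
    (hf₁ : ∀ i, Differentiable ℂ (f₁ i)) (hf₂ : ∀ i, Differentiable ℂ (f₂ i)) (ζ s : ι → ℂ)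
    {m : ℕ} (T : ℕ) (hm : 1 ≤ m)
    (hT : ∀ w : ι → ℕ × ℕ, Function.Injective w → T ≤ ∑ i, ((w i).1 + m * (w i).2)) :
    ∃ g : ℂ → ℂ, Differentiable ℂ g ∧
      ∀ t, (Matrix.of fun i j => f₁ i (t * ζ j) * f₂ i (t ^ m * s j)).det = t ^ T * g t := by
  classical
  choose c₁ g₁ hg₁ h₁ using fun i => (hf₁ i).exists_eq_sum_add_pow_mul T
  choose c₂ g₂ hg₂ h₂ using fun i => (hf₂ i).exists_eq_sum_add_pow_mul T
  let X : entireFunctions := ⟨fun t => t, differentiable_id⟩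
  let C : ℂ → entireFunctions := fun a => ⟨fun _ => a, differentiable_const a⟩
  let A : Matrix ι ι entireFunctions := Matrix.of fun i j =>
    ⟨fun t => f₁ i (t * ζ j) * f₂ i (t ^ m * s j),
      ((hf₁ i).comp (differentiable_id.mul_const _)).mul
        ((hf₂ i).comp ((differentiable_id.pow m).mul_const _))⟩
  let Φ : Matrix ι (Fin T × Fin T) entireFunctions := Matrix.of fun i w =>
    C (c₁ i w.1 * c₂ i w.2) * X ^ ((w.1 : ℕ) + m * w.2)
  let Ψ : Matrix (Fin T × Fin T) ι entireFunctions := Matrix.of fun w j =>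
    C (ζ j ^ (w.1 : ℕ) * s j ^ (w.2 : ℕ))
  have hd1 : X ^ T ∣ A.det - (Φ * Ψ).det := by
    refine Matrix.det_congr_mod _ _ _ fun i j => ?_
    have hG₁ : Differentiable ℂ fun t => g₁ i (t * ζ j) :=
      (hg₁ i).comp (differentiable_id.mul_const _)
    have hG₂ : Differentiable ℂ fun t => g₂ i (t ^ m * s j) :=
      (hg₂ i).comp ((differentiable_id.pow m).mul_const _)
    have hF₂ : Differentiable ℂ fun t => f₂ i (t ^ m * s j) :=
      (hf₂ i).comp ((differentiable_id.pow m).mul_const _)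
    refine ⟨⟨fun t => ζ j ^ T * g₁ i (t * ζ j) * f₂ i (t ^ m * s j) +
      (∑ a ∈ Finset.range T, c₁ i a * (t * ζ j) ^ a) *
        (t ^ (m * T - T) * s j ^ T * g₂ i (t ^ m * s j)), ?_⟩, ?_⟩
    · show Differentiable ℂ _
      fun_prop
    · apply Subtype.ext
      funext t
      have hsum : ((Φ * Ψ) i j : ℂ → ℂ) t = (∑ a ∈ Finset.range T, c₁ i a * (t * ζ j) ^ a) *
          ∑ a ∈ Finset.range T, c₂ i a * (t ^ m * s j) ^ a := by
        rw [Matrix.mul_apply, Finset.sum_range, Finset.sum_range, Finset.sum_mul_sum,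
          Fintype.sum_prod_type]
        simp only [AddSubmonoidClass.coe_finsetSum, Finset.sum_apply]
        refine Finset.sum_congr rfl fun a _ => Finset.sum_congr rfl fun b _ => ?_
        simp only [Φ, Ψ, X, C, Matrix.of_apply, Subring.coe_mul, Subring.coe_pow, Pi.mul_apply,
          Pi.pow_apply]
        rw [mul_pow, mul_pow, pow_add, pow_mul]
        ring
      have hpow : t ^ (m * T) = t ^ T * t ^ (m * T - T) := by
        rw [← pow_add]; congr 1
        have := Nat.mul_le_mul_right T hm
        omega
      show f₁ i (t * ζ j) * f₂ i (t ^ m * s j) - ((Φ * Ψ) i j : ℂ → ℂ) t = t ^ T * (_ + _)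
      rw [hsum]
      have e1 := h₁ i (t * ζ j)
      have e2 := h₂ i (t ^ m * s j)
      rw [mul_pow (t ^ m), ← pow_mul, hpow] at e2
      rw [mul_pow] at e1
      linear_combination f₂ i (t ^ m * s j) * e1 +
        (∑ a ∈ Finset.range T, c₁ i a * (t * ζ j) ^ a) * e2
  have hd2 : X ^ T ∣ (Φ * Ψ).det := by
    refine Matrix.dvd_det_mul_of_injective _ _ _ fun f hf => ?_
    have h3 := hT (fun i => ((f i).1, (f i).2)) (by
      intro i j hij
      simp only [Prod.mk.injEq] at hij
      exact hf (Prod.ext (Fin.ext hij.1) (Fin.ext hij.2)))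
    simp only [Φ, Matrix.of_apply]
    rw [Finset.prod_mul_distrib, Finset.prod_pow_eq_pow_sum]
    exact Dvd.dvd.mul_left (pow_dvd_pow _ h3) _
  obtain ⟨g, hg⟩ : X ^ T ∣ A.det := by simpa using dvd_add hd1 hd2
  refine ⟨g, g.2, fun t => ?_⟩
  have h5 := congrFun (congrArg Subtype.val hg) t
  let ev : entireFunctions →+* ℂ := (Pi.evalRingHom (fun _ : ℂ => ℂ) t).comp entireFunctions.subtype
  have h6 : ev A.det = t ^ T * (g : ℂ → ℂ) t := h5
  rw [← h6, RingHom.map_det]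
  rfl

/-- Schwarz lemma for an interpolation determinant in the two directions `ζ` and `s`. -/
theorem abs_det_mul_pow_le {ι : Type*} [Fintype ι] [DecidableEq ι] (k : ι → ℕ)
    (e ζ s : ι → ℝ) {c d B G G' ρ : ℝ} {m : ℕ} (T : ℕ) (hm : 1 ≤ m) (hc : 0 ≤ c) (hd : 0 ≤ d)
    (hρ : 1 ≤ ρ) (hB : 0 ≤ B) (hζ : ∀ j, |ζ j| ≤ B)
    (hG : ∀ σ : Equiv.Perm ι, |∑ j, e (σ j) * ζ j| ≤ G)
    (hG' : ∀ σ : Equiv.Perm ι, |∑ j, e (σ j) * s j| ≤ G')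
    (hT : ∀ w : ι → ℕ × ℕ, Function.Injective w → T ≤ ∑ i, ((w i).1 + m * (w i).2)) :
    |(Matrix.of fun i j => ζ j ^ k i * Real.exp (e i * (c * ζ j + d * s j))).det| * ρ ^ T ≤
      (Fintype.card ι).factorial * (ρ * B) ^ (∑ i, k i) *
        Real.exp (ρ * (c * G) + ρ ^ m * (d * G')) := by
  have hρ0 : 0 < ρ := by linarith
  obtain ⟨g, hg, h⟩ := exists_det_eq_pow_mul
    (fun i z => z ^ k i * Complex.exp (e i * c * z)) (fun i z => Complex.exp (e i * d * z))
    (fun i => by fun_prop) (fun i => by fun_prop) (fun j => (ζ j : ℂ)) (fun j => (s j : ℂ))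
    T hm hT
  have h1 : ((Matrix.of fun i j => ζ j ^ k i * Real.exp (e i * (c * ζ j + d * s j))).det : ℂ)
      = g 1 := by
    have h2 := h 1
    simp only [one_mul, one_pow] at h2
    rw [← h2]
    have := RingHom.map_det Complex.ofRealHom
      (Matrix.of fun i j => ζ j ^ k i * Real.exp (e i * (c * ζ j + d * s j)))
    rw [Complex.ofRealHom_eq_coe] at this
    rw [this]
    congr 1
    ext i j
    simp only [RingHom.mapMatrix_apply, Matrix.map_apply, Matrix.of_apply, Complex.ofRealHom_eq_coe]
    push_cast
    rw [mul_assoc, ← Complex.exp_add]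
    congr 2; ring
  have h3 : ∀ t : ℂ, ‖t‖ = ρ → ‖g t‖ ≤ (Fintype.card ι).factorial * (ρ * B) ^ (∑ i, k i) *
        Real.exp (ρ * (c * G) + ρ ^ m * (d * G')) / ρ ^ T := by
    intro t ht
    rw [le_div_iff₀ (pow_pos hρ0 T), mul_comm]
    have h4 : ‖t ^ T * g t‖ = ρ ^ T * ‖g t‖ := by rw [norm_mul, norm_pow, ht]
    rw [← h4, ← h t, Matrix.det_apply]
    refine (norm_sum_le _ _).trans ?_
    have h5 : ∀ σ ∈ (Finset.univ : Finset (Equiv.Perm ι)),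
        ‖Equiv.Perm.sign σ • ∏ i, (Matrix.of fun i j => (t * (ζ j : ℂ)) ^ k i *
          Complex.exp (e i * c * (t * ζ j)) * Complex.exp (e i * d * (t ^ m * s j))) (σ i) i‖ ≤
        (ρ * B) ^ (∑ i, k i) * Real.exp (ρ * (c * G) + ρ ^ m * (d * G')) := by
      intro σ _
      have h6 : ‖Equiv.Perm.sign σ • ∏ i, (Matrix.of fun i j => (t * (ζ j : ℂ)) ^ k i *
          Complex.exp (e i * c * (t * ζ j)) * Complex.exp (e i * d * (t ^ m * s j))) (σ i) i‖ =
          ‖∏ i, (Matrix.of fun i j => (t * (ζ j : ℂ)) ^ k i *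
          Complex.exp (e i * c * (t * ζ j)) * Complex.exp (e i * d * (t ^ m * s j))) (σ i) i‖ := by
        rcases Int.units_eq_one_or (Equiv.Perm.sign σ) with hs | hs <;> simp [hs]
      rw [h6]
      simp only [Matrix.of_apply]
      simp only [Finset.prod_mul_distrib]
      rw [mul_assoc, norm_mul]
      refine mul_le_mul ?_ ?_ (norm_nonneg _) (pow_nonneg (mul_nonneg hρ0.le hB) _)
      · rw [norm_prod, ← Equiv.sum_comp σ, ← Finset.prod_pow_eq_pow_sum]
        refine Finset.prod_le_prod (fun _ _ => norm_nonneg _) fun i _ => ?_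
        rw [norm_pow, norm_mul, ht, Complex.norm_real]
        exact pow_le_pow_left₀ (by positivity) (mul_le_mul_of_nonneg_left (hζ i) hρ0.le) _
      · rw [← Complex.exp_sum, ← Complex.exp_sum, ← Complex.exp_add, Complex.norm_exp,
          Real.exp_le_exp]
        have e1 : ∑ i, (e (σ i) : ℂ) * c * (t * ζ i) + ∑ i, (e (σ i) : ℂ) * d * (t ^ m * s i) =
            t * ((c * ∑ i, e (σ i) * ζ i : ℝ) : ℂ) + t ^ m * ((d * ∑ i, e (σ i) * s i : ℝ) : ℂ) := by
          push_cast
          simp only [Finset.mul_sum]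
          congr 1 <;> refine Finset.sum_congr rfl fun i _ => ?_ <;> ring
        rw [e1]
        refine (Complex.re_le_norm _).trans ((norm_add_le _ _).trans ?_)
        rw [norm_mul, norm_mul, norm_pow, ht, Complex.norm_real, Complex.norm_real, Real.norm_eq_abs,
          Real.norm_eq_abs, abs_mul, abs_mul, abs_of_nonneg hc, abs_of_nonneg hd]
        have := hG σ
        have := hG' σ
        gcongr
    refine (Finset.sum_le_card_nsmul _ _ _ h5).trans (le_of_eq ?_)
    rw [Finset.card_univ, Fintype.card_perm, nsmul_eq_mul, mul_assoc]
  have h7 : ‖g 1‖ ≤ (Fintype.card ι).factorial * (ρ * B) ^ (∑ i, k i) *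
        Real.exp (ρ * (c * G) + ρ ^ m * (d * G')) / ρ ^ T := by
    refine Complex.norm_le_of_forall_mem_frontier_norm_le (U := Metric.ball 0 ρ)
      Metric.isBounded_ball hg.diffContOnCl (fun t ht => h3 t ?_) ?_
    · rw [frontier_ball _ hρ0.ne'] at ht
      simpa using ht
    · rw [closure_ball _ hρ0.ne']
      simpa using hρ
  rw [← h1, Complex.norm_real, Real.norm_eq_abs, le_div_iff₀ (pow_pos hρ0 T)] at h7
  exact h7

theorem sum_weight_ge {ι : Type*} [Fintype ι] {M : ℕ} (hι : Fintype.card ι = 4 * M)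
    (w : ι → ℕ × ℕ) (hw : Function.Injective w) :
    7 * M ^ 2 - 2 * M ≤ ∑ i, ((w i).1 + 2 * M * (w i).2) := by
  classical
  -- weight deficit
  have key : ∀ P : Finset (ℕ × ℕ), ∑ p ∈ P, ((3 * M : ℤ) - (p.1 + 2 * M * p.2)) ≤
      5 * M ^ 2 + 2 * M := by
    intro P
    let P₀ := (Finset.range (3 * M)).image fun a => (a, 0)
    let P₁ := (Finset.range M).image fun a => (a, 1)
    have hz : ∀ n : ℕ, ∑ a ∈ Finset.range n, ((n : ℤ) - a) * 2 = n * (n + 1) := by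
      intro n
      induction n with
      | zero => simp
      | succ n ih =>
        rw [Finset.sum_range_succ]
        have : ∑ a ∈ Finset.range n, (((n + 1 : ℕ) : ℤ) - a) * 2 =
            ∑ a ∈ Finset.range n, ((n : ℤ) - a) * 2 + 2 * n := by
          rw [← sub_eq_iff_eq_add', ← Finset.sum_sub_distrib]
          simp [← sub_mul]; ring
        rw [this, ih]; push_cast; ring
    have hsub : P ∩ (P₀ ∪ P₁) ⊆ P₀ ∪ P₁ := Finset.inter_subset_right
    calc ∑ p ∈ P, ((3 * M : ℤ) - (p.1 + 2 * M * p.2))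
        ≤ ∑ p ∈ P ∩ (P₀ ∪ P₁), ((3 * M : ℤ) - (p.1 + 2 * M * p.2)) := by
          rw [← Finset.sum_inter_add_sum_sdiff P (P₀ ∪ P₁), add_le_iff_nonpos_right]
          refine Finset.sum_nonpos fun p hp => ?_
          obtain ⟨a, n⟩ := p
          rw [Finset.mem_sdiff, Finset.mem_union, not_or] at hp
          obtain ⟨-, hp0, hp1⟩ := hp
          simp only [P₀, P₁, Finset.mem_image, Finset.mem_range, Prod.mk.injEq, not_exists,
            not_and] at hp0 hp1
          rcases n with _ | _ | n
          · have : ¬ a < 3 * M := fun h => hp0 a h rfl rfl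
            push_cast; omega
          · have : ¬ a < M := fun h => hp1 a h rfl rfl
            push_cast; omega
          · push_cast; nlinarith [mul_nonneg (Nat.cast_nonneg (α := ℤ) M) (Nat.cast_nonneg n)]
      _ ≤ ∑ p ∈ P₀ ∪ P₁, ((3 * M : ℤ) - (p.1 + 2 * M * p.2)) := by
          refine Finset.sum_le_sum_of_subset_of_nonneg hsub fun p hp _ => ?_
          simp only [P₀, P₁, Finset.mem_union, Finset.mem_image, Finset.mem_range] at hp
          rcases hp with ⟨a, ha, rfl⟩ | ⟨a, ha, rfl⟩ <;> push_cast <;> omega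
      _ = _ := by
          rw [Finset.sum_union, Finset.sum_image, Finset.sum_image]
          · have h0 := hz (3 * M)
            have h1 := hz M
            rw [← Finset.sum_mul] at h0 h1
            have h2 : ∑ a ∈ Finset.range M, ((3 * M : ℤ) - (((a, 1) : ℕ × ℕ).1 +
                2 * M * (((a, 1) : ℕ × ℕ).2 : ℕ))) = ∑ a ∈ Finset.range M, ((M : ℤ) - a) :=
              Finset.sum_congr rfl fun a _ => by push_cast; ring
            have h3 : ∑ a ∈ Finset.range (3 * M), ((3 * M : ℤ) - (((a, 0) : ℕ × ℕ).1 +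
                2 * M * (((a, 0) : ℕ × ℕ).2 : ℕ))) =
                ∑ a ∈ Finset.range (3 * M), (((3 * M : ℕ) : ℤ) - a) :=
              Finset.sum_congr rfl fun a _ => by push_cast; ring
            rw [h2, h3]
            push_cast at h0 ⊢
            linarith
          · intro a _ b _ hab; simpa using hab
          · intro a _ b _ hab; simpa using hab
          · rw [Finset.disjoint_left]
            rintro p hp hq
            simp only [P₀, P₁, Finset.mem_image, Finset.mem_range] at hp hq
            obtain ⟨a, -, rfl⟩ := hp
            obtain ⟨b, -, hb⟩ := hq
            simp at hb
  have h1 := key (Finset.univ.image w)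
  rw [Finset.sum_image hw.injOn, Finset.sum_sub_distrib, Finset.sum_const, Finset.card_univ, hι] at h1
  have h2 : (7 * M ^ 2 : ℤ) ≤ ((∑ i, ((w i).1 + 2 * M * (w i).2) + 2 * M : ℕ) : ℤ) := by
    push_cast at h1 ⊢
    rw [nsmul_eq_mul] at h1
    push_cast at h1
    linarith
  have h3 : 7 * M ^ 2 ≤ ∑ i, ((w i).1 + 2 * M * (w i).2) + 2 * M := by exact_mod_cast h2
  omega

section

open Polynomial

theorem exists_nat_eq_exp_mul {p q : ℕ} (hp : 0 < p) (hq : 0 < q) {lo hi E : ℤ} (h₁ : lo ≤ E)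
    (h₂ : E ≤ hi) (C : ℝ) :
    ∃ n : ℕ, Real.exp ((Real.log p - Real.log q) * (E - C)) *
      Real.exp ((C - lo) * Real.log p + (hi - C) * Real.log q) = n := by
  obtain ⟨a, ha⟩ := Int.eq_ofNat_of_zero_le (sub_nonneg.2 h₁)
  obtain ⟨b, hb⟩ := Int.eq_ofNat_of_zero_le (sub_nonneg.2 h₂)
  refine ⟨p ^ a * q ^ b, ?_⟩
  have ha' : (E : ℝ) - lo = a := by exact_mod_cast ha
  have hb' : (hi : ℝ) - E = b := by exact_mod_cast hb
  have hp' : (0 : ℝ) < p := by exact_mod_cast hp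
  have hq' : (0 : ℝ) < q := by exact_mod_cast hq
  rw [← Real.exp_add]
  push_cast
  rw [← Real.exp_log hp', ← Real.exp_log hq', ← Real.exp_nat_mul, ← Real.exp_nat_mul,
    ← Real.exp_add, Real.log_exp, Real.log_exp, ← ha', ← hb']
  congr 1; ring

/-- Liouville's inequality for a sum of monomials in two positive rationals. -/
theorem exp_neg_le_abs_sum {κ : Type*} (s : Finset κ) (a E₁ E₂ : κ → ℤ) {p₁ q₁ p₂ q₂ : ℕ}
    (hp₁ : 0 < p₁) (hq₁ : 0 < q₁) (hp₂ : 0 < p₂) (hq₂ : 0 < q₂) {C₁ C₂ G₁ G₂ : ℝ}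
    (h₁ : ∀ i ∈ s, |E₁ i - C₁| ≤ G₁) (h₂ : ∀ i ∈ s, |E₂ i - C₂| ≤ G₂)
    (hne : ∑ i ∈ s, a i * Real.exp ((Real.log p₁ - Real.log q₁) * (E₁ i - C₁) +
      (Real.log p₂ - Real.log q₂) * (E₂ i - C₂)) ≠ 0) :
    Real.exp (-(G₁ * (Real.log p₁ + Real.log q₁) + G₂ * (Real.log p₂ + Real.log q₂))) ≤
      |∑ i ∈ s, a i * Real.exp ((Real.log p₁ - Real.log q₁) * (E₁ i - C₁) +
      (Real.log p₂ - Real.log q₂) * (E₂ i - C₂))| := by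
  set S := ∑ i ∈ s, a i * Real.exp ((Real.log p₁ - Real.log q₁) * (E₁ i - C₁) +
      (Real.log p₂ - Real.log q₂) * (E₂ i - C₂)) with hS
  let W : ℝ → ℝ → ℕ → ℕ → ℝ := fun C G p q =>
    (C - (⌈C - G⌉ : ℤ)) * Real.log p + ((⌊C + G⌋ : ℤ) - C) * Real.log q
  have hW : ∀ C G : ℝ, ∀ p q : ℕ, W C G p q ≤ G * (Real.log p + Real.log q) := by
    intro C G p q
    have e1 := Int.le_ceil (C - G)
    have e2 := Int.floor_le (C + G)
    have e3 := Real.log_natCast_nonneg p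
    have e4 := Real.log_natCast_nonneg q
    simp only [W]
    nlinarith
  have hterm : ∀ (C G : ℝ) (p q : ℕ) (E : ℤ), 0 < p → 0 < q → |(E : ℝ) - C| ≤ G →
      ∃ n : ℕ, Real.exp ((Real.log p - Real.log q) * (E - C)) * Real.exp (W C G p q) = n := by
    intro C G p q E hp hq hE
    rw [abs_le] at hE
    exact exists_nat_eq_exp_mul hp hq (Int.ceil_le.2 (by linarith)) (Int.le_floor.2 (by linarith)) C
  obtain ⟨z, hz⟩ : ∃ z : ℤ, S * (Real.exp (W C₁ G₁ p₁ q₁) * Real.exp (W C₂ G₂ p₂ q₂)) = z := by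
    have : ∀ i, ∃ n : ℤ, i ∈ s → a i * Real.exp ((Real.log p₁ - Real.log q₁) * (E₁ i - C₁) +
      (Real.log p₂ - Real.log q₂) * (E₂ i - C₂)) *
        (Real.exp (W C₁ G₁ p₁ q₁) * Real.exp (W C₂ G₂ p₂ q₂)) = n := by
      intro i
      by_cases hi : i ∈ s
      · obtain ⟨n₁, hn₁⟩ := hterm _ _ _ _ _ hp₁ hq₁ (h₁ i hi)
        obtain ⟨n₂, hn₂⟩ := hterm _ _ _ _ _ hp₂ hq₂ (h₂ i hi)
        refine ⟨a i * n₁ * n₂, fun _ => ?_⟩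
        push_cast
        rw [← hn₁, ← hn₂, Real.exp_add]
        ring
      · exact ⟨0, fun h => absurd h hi⟩
    choose n hn using this
    refine ⟨∑ i ∈ s, n i, ?_⟩
    rw [hS, Finset.sum_mul]
    push_cast
    exact Finset.sum_congr rfl fun i hi => hn i hi
  have hz0 : z ≠ 0 := by
    rintro rfl
    rw [Int.cast_zero, mul_eq_zero] at hz
    exact hz.elim hne (by positivity)
  have h3 : (1 : ℝ) ≤ |S| * (Real.exp (W C₁ G₁ p₁ q₁) * Real.exp (W C₂ G₂ p₂ q₂)) := by
    have h4 : (1 : ℝ) ≤ |(z : ℝ)| := by exact_mod_cast Int.one_le_abs hz0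
    rw [← hz, abs_mul, abs_of_pos (by positivity : 0 < Real.exp (W C₁ G₁ p₁ q₁) * _)] at h4
    exact h4
  rw [Real.exp_neg, inv_le_iff_one_le_mul₀ (Real.exp_pos _)]
  refine h3.trans (mul_le_mul_of_nonneg_left ?_ (abs_nonneg _))
  rw [← Real.exp_add, Real.exp_le_exp]
  exact add_le_add (hW _ _ _ _) (hW _ _ _ _)

/-- Passing from centred powers to binomial coefficients in the interpolation determinant. -/
theorem det_pow_eq_prod_mul_det_choose {K : ℕ} {Λ : Type*} [Fintype Λ] [DecidableEq Λ]
    (u : Fin K × Λ → ℕ) (η : ℝ) (E : Λ → Fin K × Λ → ℝ) :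
    (Matrix.of fun i j => ((u j : ℝ) - η) ^ (i.1 : ℕ) * E i.2 j).det =
      (∏ i : Fin K × Λ, ((i.1 : ℕ).factorial : ℝ)) *
        (Matrix.of fun i j => ((u j).choose i.1 : ℝ) * E i.2 j).det := by
  let P : ℕ → ℝ[X] := fun k => (descPochhammer ℝ k).comp (X + C η)
  have hP : ∀ k, (P k).natDegree = k := fun k => by
    have := natDegree_comp (p := descPochhammer ℝ k) (q := X + C η)
    rwa [natDegree_X_add_C, mul_one, descPochhammer_natDegree] at this
  have hPm : ∀ k, (P k).Monic := fun k => (monic_descPochhammer ℝ k).comp_X_add_C η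
  let T : Matrix (Fin K) (Fin K) ℝ := Matrix.of fun k k' => (P k).coeff k'
  have hT : T.det = 1 := by
    rw [Matrix.det_of_isLowerTriangular T]
    · refine Finset.prod_eq_one fun k _ => ?_
      have := hPm k
      rwa [Monic, leadingCoeff, hP] at this
    · intro i j hij
      exact coeff_eq_zero_of_natDegree_lt ((hP i).trans_lt hij)
  rw [← Matrix.det_mul_column]
  have hM : (Matrix.of fun i j : Fin K × Λ => ((i.1 : ℕ).factorial : ℝ) *
      (Matrix.of fun i j : Fin K × Λ => ((u j).choose i.1 : ℝ) * E i.2 j) i j) =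
      (Matrix.kroneckerMap (· * ·) T (1 : Matrix Λ Λ ℝ)) *
        (Matrix.of fun i j => ((u j : ℝ) - η) ^ (i.1 : ℕ) * E i.2 j) := by
    ext i j
    obtain ⟨k, l⟩ := i
    rw [Matrix.mul_apply, Fintype.sum_prod_type]
    simp only [Matrix.of_apply, Matrix.kroneckerMap_apply, Matrix.one_apply]
    have h1 : ((u j).descFactorial k : ℝ) = ∑ k' : Fin K, (P k).coeff k' * ((u j : ℝ) - η) ^ (k' : ℕ) := by
      rw [Fin.sum_univ_eq_sum_range (fun k' => (P k).coeff k' * ((u j : ℝ) - η) ^ k') K]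
      rw [← eval_eq_sum_range' (by rw [hP]; exact k.2)]
      simp [P, descPochhammer_eval_eq_descFactorial]
    rw [← mul_assoc, ← Nat.cast_mul, ← Nat.descFactorial_eq_factorial_mul_choose, h1,
      Finset.sum_mul]
    refine Finset.sum_congr rfl fun k' _ => ?_
    simp [T, mul_assoc]
  rw [hM, Matrix.det_mul, Matrix.det_kronecker, hT]
  simp

end

theorem sum_range_sub_sq (n : ℕ) (c : ℝ) :
    ∑ k ∈ Finset.range n, ((k : ℝ) - c) ^ 2 =
      n * (n - 1) * (2 * n - 1) / 6 - c * n * (n - 1) + n * c ^ 2 := by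
  induction n with
  | zero => simp
  | succ n ih => rw [Finset.sum_range_succ, ih]; push_cast; ring

theorem sum_range_sub_center_sq_le (n : ℕ) :
    ∑ k ∈ Finset.range n, ((k : ℝ) - ((n : ℝ) - 1) / 2) ^ 2 ≤ (n : ℝ) ^ 3 / 12 := by
  rw [sum_range_sub_sq]
  have : (0 : ℝ) ≤ n := Nat.cast_nonneg n
  nlinarith

theorem sum_fin_prod_sub_center_sq_le (K L : ℕ) :
    ∑ i : Fin K × Fin L, (((i.2 : ℕ) : ℝ) - ((L : ℝ) - 1) / 2) ^ 2 ≤ K * ((L : ℝ) ^ 3 / 12) := by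
  rw [Fintype.sum_prod_type]
  simp only [Finset.sum_const, Finset.card_univ, Fintype.card_fin, nsmul_eq_mul]
  rw [Fin.sum_univ_eq_sum_range (fun k => ((k : ℝ) - ((L : ℝ) - 1) / 2) ^ 2) L]
  exact mul_le_mul_of_nonneg_left (sum_range_sub_center_sq_le L) (Nat.cast_nonneg K)

theorem sum_fin_prod_sub_center (K L : ℕ) :
    ∑ i : Fin K × Fin L, (((i.2 : ℕ) : ℝ) - ((L : ℝ) - 1) / 2) = 0 := by
  rw [Fintype.sum_prod_type]
  simp only [Finset.sum_const, Finset.card_univ, Fintype.card_fin, nsmul_eq_mul]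
  rw [Fin.sum_univ_eq_sum_range (fun k => ((k : ℝ) - ((L : ℝ) - 1) / 2)) L]
  have : ∀ n : ℕ, ∀ c : ℝ, ∑ k ∈ Finset.range n, ((k : ℝ) - c) = n * (n - 1) / 2 - n * c := by
    intro n c
    induction n with
    | zero => simp
    | succ n ih => rw [Finset.sum_range_succ, ih]; push_cast; ring
  rw [this]; ring

theorem sum_fst_sub_center_sq_le {ι : Type*} [Fintype ι] {R S : ℕ} {pt : ι → ℕ × ℕ}
    (hinj : Function.Injective pt) (hpt : ∀ i, (pt i).1 < R ∧ (pt i).2 < S) :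
    ∑ i, (((pt i).1 : ℝ) - ((R : ℝ) - 1) / 2) ^ 2 ≤ S * ((R : ℝ) ^ 3 / 12) := by
  classical
  calc ∑ i, (((pt i).1 : ℝ) - ((R : ℝ) - 1) / 2) ^ 2
      = ∑ p ∈ Finset.univ.image pt, ((p.1 : ℝ) - ((R : ℝ) - 1) / 2) ^ 2 := by
        rw [Finset.sum_image hinj.injOn]
    _ ≤ ∑ p ∈ Finset.range R ×ˢ Finset.range S, ((p.1 : ℝ) - ((R : ℝ) - 1) / 2) ^ 2 := by
        refine Finset.sum_le_sum_of_subset_of_nonneg ?_ fun _ _ _ => sq_nonneg _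
        intro p hp
        obtain ⟨i, -, rfl⟩ := Finset.mem_image.1 hp
        simpa using hpt i
    _ = S * ∑ k ∈ Finset.range R, ((k : ℝ) - ((R : ℝ) - 1) / 2) ^ 2 := by
        rw [Finset.sum_product]
        simp [Finset.mul_sum]
    _ ≤ _ := mul_le_mul_of_nonneg_left (sum_range_sub_center_sq_le R) (Nat.cast_nonneg S)

theorem sum_snd_sub_center_sq_le {ι : Type*} [Fintype ι] {R S : ℕ} {pt : ι → ℕ × ℕ}
    (hinj : Function.Injective pt) (hpt : ∀ i, (pt i).1 < R ∧ (pt i).2 < S) :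
    ∑ i, (((pt i).2 : ℝ) - ((S : ℝ) - 1) / 2) ^ 2 ≤ R * ((S : ℝ) ^ 3 / 12) :=
  sum_fst_sub_center_sq_le (pt := fun i => (pt i).swap) (Prod.swap_injective.comp hinj)
    fun i => (hpt i).symm

theorem abs_sum_perm_mul_le {ι : Type*} [Fintype ι] {e s : ι → ℝ} {X Y G : ℝ}
    (he : ∑ i, e i ^ 2 ≤ X) (hs : ∑ i, s i ^ 2 ≤ Y) (hG : 0 ≤ G) (hXY : X * Y ≤ G ^ 2)
    (σ : Equiv.Perm ι) : |∑ j, e (σ j) * s j| ≤ G := by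
  refine abs_le_of_sq_le_sq ?_ hG
  refine (Finset.sum_mul_sq_le_sq_mul_sq _ _ _).trans (le_trans ?_ hXY)
  rw [Equiv.sum_comp σ (fun i => e i ^ 2)]
  exact mul_le_mul he hs (Finset.sum_nonneg fun _ _ => sq_nonneg _)
    ((Finset.sum_nonneg fun _ _ => sq_nonneg _).trans he)

/-- Arithmetic lower bound for the interpolation determinant. -/
theorem exp_neg_mul_le_abs_interp_det {K L p₁ q₁ p₂ q₂ b₁ b₂ : ℕ} (hp₁ : 0 < p₁) (hq₁ : 0 < q₁)
    (hp₂ : 0 < p₂) (hq₂ : 0 < q₂) (pt : Fin K × Fin L → ℕ × ℕ) (η y₀ : ℝ) {G₁ G₂ c₁ c₂ : ℝ}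
    (hG₁ : ∀ σ : Equiv.Perm (Fin K × Fin L),
      |∑ j, (((σ j).2 : ℕ) - ((L : ℝ) - 1) / 2) * ((pt j).1 - c₁)| ≤ G₁)
    (hG₂ : ∀ σ : Equiv.Perm (Fin K × Fin L),
      |∑ j, (((σ j).2 : ℕ) - ((L : ℝ) - 1) / 2) * ((pt j).2 - c₂)| ≤ G₂)
    (hne : (Matrix.of fun i j => interpEntry (b₂ : ℝ) b₁ η (Real.log p₁ - Real.log q₁)
      (Real.log p₂ - Real.log q₂) y₀ (((L : ℝ) - 1) / 2) i (pt j)).det ≠ 0) :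
    (∏ i : Fin K × Fin L, ((i.1 : ℕ).factorial : ℝ)) *
      Real.exp (-(G₁ * (Real.log p₁ + Real.log q₁) + G₂ * (Real.log p₂ + Real.log q₂))) ≤
    |(Matrix.of fun i j => interpEntry (b₂ : ℝ) b₁ η (Real.log p₁ - Real.log q₁)
      (Real.log p₂ - Real.log q₂) y₀ (((L : ℝ) - 1) / 2) i (pt j)).det| := by
  set c₀ : ℝ := ((L : ℝ) - 1) / 2 with hc₀
  set x₁ := Real.log p₁ - Real.log q₁ with hx₁
  set x₂ := Real.log p₂ - Real.log q₂ with hx₂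
  let u : Fin K × Fin L → ℕ := fun j => (pt j).1 * b₂ + (pt j).2 * b₁
  have hz : ∀ σ : Equiv.Perm (Fin K × Fin L), ∑ j, (((σ j).2 : ℕ) - c₀ : ℝ) = 0 := fun σ => by
    rw [Equiv.sum_comp σ (fun i => (((i.2 : ℕ) : ℝ) - c₀))]
    exact sum_fin_prod_sub_center K L
  let E : Fin L → Fin K × Fin L → ℝ := fun l j =>
    Real.exp (((l : ℕ) - c₀) * ((pt j).1 * x₁ + (pt j).2 * x₂ - y₀))
  have hform : (Matrix.of fun i j : Fin K × Fin L => interpEntry (b₂ : ℝ) b₁ η x₁ x₂ y₀ c₀ i (pt j)) =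
      Matrix.of fun i j : Fin K × Fin L => ((u j : ℝ) - η) ^ (i.1 : ℕ) * E i.2 j := by
    ext i j
    simp [interpEntry, u, E]
  rw [hform, det_pow_eq_prod_mul_det_choose] at hne ⊢
  rw [abs_mul, abs_of_nonneg (by positivity)]
  refine mul_le_mul_of_nonneg_left ?_ (by positivity)
  have hdet : (Matrix.of fun i j : Fin K × Fin L => ((u j).choose i.1 : ℝ) * E i.2 j).det =
      ∑ σ : Equiv.Perm (Fin K × Fin L),
        ((Equiv.Perm.sign σ * ∏ j, ((u j).choose (σ j).1 : ℤ) : ℤ) : ℝ) *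
        Real.exp (x₁ * (((∑ j, ((σ j).2 : ℕ) * (pt j).1 : ℕ) : ℤ) - c₀ * ∑ j, ((pt j).1 : ℝ)) +
          x₂ * (((∑ j, ((σ j).2 : ℕ) * (pt j).2 : ℕ) : ℤ) - c₀ * ∑ j, ((pt j).2 : ℝ))) := by
    rw [Matrix.det_apply]
    refine Finset.sum_congr rfl fun σ _ => ?_
    simp only [Matrix.of_apply]
    rw [Finset.prod_mul_distrib, ← Real.exp_sum, Units.smul_def, zsmul_eq_mul, ← mul_assoc]
    push_cast
    congr 2
    have : ∑ j, (((σ j).2 : ℕ) - c₀) * ((pt j).1 * x₁ + (pt j).2 * x₂ - y₀) =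
      x₁ * (∑ j, (((σ j).2 : ℕ) : ℝ) * (pt j).1 - c₀ * ∑ j, ((pt j).1 : ℝ)) +
          x₂ * (∑ j, (((σ j).2 : ℕ) : ℝ) * (pt j).2 - c₀ * ∑ j, ((pt j).2 : ℝ)) -
          y₀ * ∑ j, (((σ j).2 : ℕ) - c₀ : ℝ) := by
      simp only [Finset.mul_sum, ← Finset.sum_sub_distrib, ← Finset.sum_add_distrib]
      exact Finset.sum_congr rfl fun j _ => by ring
    rw [this, hz, mul_zero, sub_zero]
  have hshift : ∀ (σ : Equiv.Perm (Fin K × Fin L)) (f : Fin K × Fin L → ℕ) (c : ℝ),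
      (((∑ j, ((σ j).2 : ℕ) * f j : ℕ) : ℤ) : ℝ) - c₀ * ∑ j, (f j : ℝ) =
        ∑ j, (((σ j).2 : ℕ) - c₀) * (f j - c) := by
    intro σ f c
    have : ∑ j, (((σ j).2 : ℕ) - c₀) * (f j - c) =
        ∑ j, (((σ j).2 : ℕ) - c₀) * (f j : ℝ) - c * ∑ j, (((σ j).2 : ℕ) - c₀ : ℝ) := by
      simp only [Finset.mul_sum, ← Finset.sum_sub_distrib]
      exact Finset.sum_congr rfl fun j _ => by ring
    rw [this, hz, mul_zero, sub_zero]
    push_cast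
    simp only [Finset.mul_sum, ← Finset.sum_sub_distrib]
    exact Finset.sum_congr rfl fun j _ => by ring
  rw [hdet] at hne ⊢
  refine exp_neg_le_abs_sum Finset.univ _ _ _ hp₁ hq₁ hp₂ hq₂ ?_ ?_ (right_ne_zero_of_mul hne)
  · intro σ _
    rw [hshift σ (fun j => (pt j).1) c₁]
    exact hG₁ σ
  · intro σ _
    rw [hshift σ (fun j => (pt j).2) c₂]
    exact hG₂ σ

/-- The interpolation-determinant inequality for a positive linear form in two logarithms. -/
theorem two_logs_interp_inequality {K L M R₁ S₁ R₂ S₂ R S p₁ q₁ p₂ q₂ b₁ b₂ : ℕ}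
    (hK : 0 < K) (hM : 0 < M) (hKL : K * L = 4 * M)
    (hp₁ : 0 < p₁) (hq₁ : 0 < q₁) (hp₂ : 0 < p₂) (hq₂ : 0 < q₂) (hb₂ : 0 < b₂)
    (hR : R = R₁ + R₂ - 1) (hS : S = S₁ + S₂ - 1) {x₁ x₂ B g τ : ℝ}
    (hx₁ : x₁ = Real.log p₁ - Real.log q₁) (hx₂ : x₂ = Real.log p₂ - Real.log q₂)
    (hx₁' : 0 ≤ x₁)
    (hx : Function.Injective fun p : ℕ × ℕ => (p.1 * x₁ + p.2 * x₂ : ℝ))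
    (hβ : Set.InjOn (fun p : ℕ × ℕ => (p.1 * (b₂ : ℝ) + p.2 * (b₁ : ℝ) : ℝ))
      (Finset.range R₂ ×ˢ Finset.range S₂ : Finset (ℕ × ℕ)))
    (h₁ : L ≤ R₁ * S₁) (h₂ : (K - 1) * L < R₂ * S₂)
    (hB : B = (((R : ℝ) - 1) * b₂ + ((S : ℝ) - 1) * b₁) / 2) (hBpos : 0 < B) (hτ : 0 ≤ τ)
    (hg : g = L / 12 * √(K * L * R * S))
    (hΛ : 0 ≤ b₂ * x₂ - b₁ * x₁)
    (hsmall : Real.exp (τ * (2 * M)) * ((b₂ * x₂ - b₁ * x₁) / b₂ * (S * g)) ≤ 1) :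
    τ * (7 * M ^ 2 - 2 * M) + L * ∑ k ∈ Finset.range K, Real.log (k.factorial) ≤
      Real.log ((K * L).factorial) + K * L * (K - 1) / 2 * (τ + Real.log B) +
        R * g * (Real.exp τ * x₁ + (Real.log p₁ + Real.log q₁)) +
        S * g * (Real.exp τ * x₂ + (Real.log p₂ + Real.log q₂)) + 1 := by
  have hb₂' : (0 : ℝ) < b₂ := by exact_mod_cast hb₂
  have hb₁' : (0 : ℝ) ≤ b₁ := by positivity
  have hg0 : 0 ≤ g := by rw [hg]; positivity
  set η : ℝ := (((R : ℝ) - 1) * b₂ + ((S : ℝ) - 1) * b₁) / 2 with hη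
  set y₀ : ℝ := (((R : ℝ) - 1) * x₁ + ((S : ℝ) - 1) * x₂) / 2 with hy₀
  obtain ⟨pt, hpt, hdet⟩ := exists_interp_det_ne_zero hK (b₂ : ℝ) b₁ η x₁ x₂ y₀
    (((L : ℝ) - 1) / 2) hx hβ h₁ h₂
  rw [← hR, ← hS] at hpt
  have hinj : Function.Injective pt := by
    intro i j hij
    by_contra hne
    exact hdet (Matrix.det_zero_of_column_eq hne fun k => by simp [hij])
  have hsq : √((K : ℝ) * L * R * S) ^ 2 = K * L * R * S := Real.sq_sqrt (by positivity)
  have hG₁ : ∀ σ : Equiv.Perm (Fin K × Fin L),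
      |∑ j, (((σ j).2 : ℕ) - ((L : ℝ) - 1) / 2) * ((pt j).1 - ((R : ℝ) - 1) / 2)| ≤ R * g :=
    abs_sum_perm_mul_le (sum_fin_prod_sub_center_sq_le K L) (sum_fst_sub_center_sq_le hinj hpt)
      (by positivity) (le_of_eq (by rw [hg, mul_pow, mul_pow, hsq]; ring))
  have hG₂ : ∀ σ : Equiv.Perm (Fin K × Fin L),
      |∑ j, (((σ j).2 : ℕ) - ((L : ℝ) - 1) / 2) * ((pt j).2 - ((S : ℝ) - 1) / 2)| ≤ S * g :=
    abs_sum_perm_mul_le (sum_fin_prod_sub_center_sq_le K L) (sum_snd_sub_center_sq_le hinj hpt)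
      (by positivity) (le_of_eq (by rw [hg, mul_pow, mul_pow, hsq]; ring))
  have hlow := exp_neg_mul_le_abs_interp_det hp₁ hq₁ hp₂ hq₂ pt η y₀ hG₁ hG₂
    (by rw [← hx₁, ← hx₂]; exact hdet)
  rw [← hx₁, ← hx₂] at hlow
  set Λ : ℝ := b₂ * x₂ - b₁ * x₁ with hΛdef
  let ζ : Fin K × Fin L → ℝ := fun j => (pt j).1 * b₂ + (pt j).2 * b₁ - η
  have hform : (Matrix.of fun i j => interpEntry (b₂ : ℝ) b₁ η x₁ x₂ y₀ (((L : ℝ) - 1) / 2) i (pt j)) =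
      Matrix.of fun i j : Fin K × Fin L => ζ j ^ (i.1 : ℕ) *
        Real.exp ((((i.2 : ℕ) : ℝ) - ((L : ℝ) - 1) / 2) *
          (x₁ / b₂ * ζ j + Λ / b₂ * ((pt j).2 - ((S : ℝ) - 1) / 2))) := by
    ext i j
    simp only [interpEntry, Matrix.of_apply, ζ]
    congr 3
    rw [hη, hy₀, hΛdef]
    field_simp
    ring
  have hζ : ∀ j, |ζ j| ≤ B := by
    intro j
    have e1 : ((pt j).1 : ℝ) ≤ R - 1 := by
      have := (hpt j).1
      rw [le_sub_iff_add_le]; exact_mod_cast this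
    have e2 : ((pt j).2 : ℝ) ≤ S - 1 := by
      have := (hpt j).2
      rw [le_sub_iff_add_le]; exact_mod_cast this
    have e3 := mul_le_mul_of_nonneg_right e1 hb₂'.le
    have e4 := mul_le_mul_of_nonneg_right e2 hb₁'
    have e5 : (0 : ℝ) ≤ (pt j).1 * b₂ := by positivity
    have e6 : (0 : ℝ) ≤ (pt j).2 * b₁ := by positivity
    simp only [ζ]
    rw [abs_le, hB, hη]
    constructor <;> linarith
  have hGζ : ∀ σ : Equiv.Perm (Fin K × Fin L),
      |∑ j, (((σ j).2 : ℕ) - ((L : ℝ) - 1) / 2) * ζ j| ≤ b₂ * (R * g) + b₁ * (S * g) := by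
    intro σ
    have : ∑ j, (((σ j).2 : ℕ) - ((L : ℝ) - 1) / 2) * ζ j =
      b₂ * (∑ j, (((σ j).2 : ℕ) - ((L : ℝ) - 1) / 2) * ((pt j).1 - ((R : ℝ) - 1) / 2)) +
      b₁ * (∑ j, (((σ j).2 : ℕ) - ((L : ℝ) - 1) / 2) * ((pt j).2 - ((S : ℝ) - 1) / 2)) := by
      rw [Finset.mul_sum, Finset.mul_sum, ← Finset.sum_add_distrib]
      refine Finset.sum_congr rfl fun j _ => ?_
      simp only [ζ, hη]
      ring
    rw [this]
    refine (abs_add_le _ _).trans (add_le_add ?_ ?_)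
    · rw [abs_mul, abs_of_pos hb₂']
      exact mul_le_mul_of_nonneg_left (hG₁ σ) hb₂'.le
    · rw [abs_mul, abs_of_nonneg hb₁']
      exact mul_le_mul_of_nonneg_left (hG₂ σ) hb₁'
  have hup := abs_det_mul_pow_le (fun i : Fin K × Fin L => (i.1 : ℕ))
    (fun i => ((i.2 : ℕ) : ℝ) - ((L : ℝ) - 1) / 2) ζ (fun j => (pt j).2 - ((S : ℝ) - 1) / 2)
    (c := x₁ / b₂) (d := Λ / b₂) (ρ := Real.exp τ) (m := 2 * M) (7 * M ^ 2 - 2 * M) (by omega)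
    (by positivity) (by positivity) (Real.one_le_exp hτ) hBpos.le hζ hGζ hG₂
    (fun w hw => sum_weight_ge (by simpa using hKL) w hw)
  rw [← hform] at hup
  have hcard : Fintype.card (Fin K × Fin L) = K * L := by simp
  have hsumk : ((∑ i : Fin K × Fin L, (i.1 : ℕ) : ℕ) : ℝ) = K * L * (K - 1) / 2 := by
    rw [Fintype.sum_prod_type_right]
    simp only [Finset.sum_const, Finset.card_univ, Fintype.card_fin, smul_eq_mul]
    rw [Fin.sum_univ_eq_sum_range (fun k => k) K]
    have : ((∑ k ∈ Finset.range K, k : ℕ) : ℝ) = K * (K - 1) / 2 := by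
      clear * -
      induction K with
      | zero => simp
      | succ n ih => rw [Finset.sum_range_succ]; push_cast at ih ⊢; rw [ih]; ring
    rw [Nat.cast_mul, this]; ring
  have hprod : Real.log (∏ i : Fin K × Fin L, ((i.1 : ℕ).factorial : ℝ)) =
      L * ∑ k ∈ Finset.range K, Real.log (k.factorial) := by
    rw [Real.log_prod (fun i _ => by positivity), Fintype.sum_prod_type_right]
    simp only [Finset.sum_const, Finset.card_univ, Fintype.card_fin, nsmul_eq_mul]
    rw [Fin.sum_univ_eq_sum_range (fun k => Real.log (k.factorial)) K]
  have hT : ((7 * M ^ 2 - 2 * M : ℕ) : ℝ) = 7 * (M : ℝ) ^ 2 - 2 * M := by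
    rw [Nat.cast_sub (by nlinarith)]; push_cast; ring
  have hmain := (mul_le_mul_of_nonneg_right hlow
    (pow_nonneg (Real.exp_pos τ).le (7 * M ^ 2 - 2 * M))).trans hup
  have hprodpos : (0 : ℝ) < ∏ i : Fin K × Fin L, ((i.1 : ℕ).factorial : ℝ) :=
    Finset.prod_pos fun i _ => by positivity
  have hlog := Real.log_le_log (by positivity) hmain
  rw [Real.log_mul (by positivity) (by positivity), Real.log_mul (by positivity) (by positivity),
    Real.log_mul (by positivity) (by positivity), Real.log_mul (by positivity) (by positivity),
    Real.log_exp, Real.log_exp, Real.log_pow, Real.log_pow, Real.log_exp,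
    Real.log_mul (by positivity) (by positivity), Real.log_exp, hsumk, hprod, hT, hcard] at hlog
  have hx₁g : x₁ / b₂ * (b₂ * (R * g) + b₁ * (S * g)) ≤ x₁ * (R * g) + x₂ * (S * g) := by
    have e1 : x₁ / b₂ * (b₂ * (R * g) + b₁ * (S * g)) =
      x₁ * (R * g) + x₂ * (S * g) - Λ / b₂ * (S * g) := by
      rw [hΛdef]; field_simp; ring
    have e2 : 0 ≤ Λ / b₂ * (S * g) := by positivity
    linarith
  have hx₁g' := mul_le_mul_of_nonneg_left hx₁g (Real.exp_pos τ).le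
  have hsm : Real.exp τ ^ (2 * M) * (Λ / b₂ * (S * g)) ≤ 1 := by
    rw [← Real.exp_nat_mul]
    push_cast
    rwa [mul_comm _ τ]
  linarith

theorem sq_mul_log_sub_le_sum_log_factorial (K : ℕ) :
    (K : ℝ) ^ 2 / 2 * (Real.log K - 3 / 2) ≤ ∑ k ∈ Finset.range K, Real.log (k.factorial) := by
  induction K with
  | zero => simp
  | succ n ih =>
    rw [Finset.sum_range_succ]
    rcases Nat.eq_zero_or_pos n with rfl | hn
    · norm_num
    have hn' : (1 : ℝ) ≤ n := by exact_mod_cast hn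
    have h1 := Stirling.le_log_factorial_stirling hn.ne'
    have h2 : (1.5 : ℝ) ≤ Real.log (2 * Real.pi) := by
      rw [Real.le_log_iff_exp_le (by positivity)]
      have e1 := Real.exp_one_lt_d9
      have e2 := Real.pi_gt_three
      have e3 : Real.exp 1.5 ^ 2 ≤ 4.5 ^ 2 := by
        rw [← Real.exp_nat_mul]
        have : ((2 : ℕ) : ℝ) * 1.5 = ((3 : ℕ) : ℝ) * 1 := by norm_num
        rw [this, Real.exp_nat_mul]
        calc Real.exp 1 ^ 3 ≤ 2.7182818286 ^ 3 := by gcongr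
          _ ≤ _ := by norm_num
      have := abs_le_of_sq_le_sq' e3 (by norm_num)
      linarith [this.2]
    have h3 : Real.log ((n : ℝ) + 1) ≤ Real.log n + 1 / n := by
      have : (n : ℝ) + 1 = n * (1 + 1 / n) := by field_simp
      rw [this, Real.log_mul (by positivity) (by positivity)]
      have := Real.log_le_sub_one_of_pos (show (0 : ℝ) < 1 + 1 / n by positivity)
      linarith
    have h4 := mul_le_mul_of_nonneg_left h3 (show (0 : ℝ) ≤ ((n : ℝ) + 1) ^ 2 / 2 by positivity)
    have h5 : ((n : ℝ) + 1) ^ 2 / 2 * (1 / n) ≤ n / 2 + 1 + 1 / 2 := by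
      have : ((n : ℝ) + 1) ^ 2 / 2 * (1 / n) = n / 2 + 1 + 1 / n / 2 := by field_simp; ring
      have h6 : 1 / (n : ℝ) ≤ 1 := by rw [div_le_one (by positivity)]; exact hn'
      linarith
    push_cast
    nlinarith

theorem log_factorial_le_mul_log (n : ℕ) : Real.log (n.factorial) ≤ n * Real.log n := by
  rw [← Real.log_pow]
  exact Real.log_le_log (by positivity) (by exact_mod_cast Nat.factorial_le_pow n)

theorem exp_nineteen_tenths_lt : Real.exp 1.9 < 6.8 := by
  have e1 := Real.exp_one_lt_d9
  have e3 : Real.exp 1.9 ^ 10 < 6.8 ^ 10 := by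
    rw [← Real.exp_nat_mul]
    have : ((10 : ℕ) : ℝ) * 1.9 = ((19 : ℕ) : ℝ) * 1 := by norm_num
    rw [this, Real.exp_nat_mul]
    calc Real.exp 1 ^ 19 ≤ 2.7182818286 ^ 19 := by gcongr
      _ < _ := by norm_num
  exact lt_of_pow_lt_pow_left₀ 10 (by norm_num) e3

theorem interp_parameters_contradict {h K L n w t Z : ℝ} (hh : 10 ≤ h) (hL : 1.4 * h ≤ L)
    (hL' : L ≤ 1.5 * h) (hK : 199 ≤ K) (hLK : L ≤ K) (hw : w ^ 2 = L) (hw0 : 0 ≤ w)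
    (hn : n ^ 2 = K * L) (hn0 : 0 < n) (ht : 0 < t) (hnt : 0.92 * h * t ≤ n) (hZ0 : 0 ≤ Z)
    (hZ : Z ≤ w + n + 0.0183 * n) :
    K * L * Real.log (K * L) +
        K * L * K / 2 * (1.6 + (h - 0.38 + Real.log ((w + n) * t / 11.9))) +
        L * n * t * Z ^ 2 / 6 + 1 <
      1.6 * (7 * (K * L / 4) ^ 2 - 2 * (K * L / 4)) + L * (K ^ 2 / 2 * (Real.log K - 3 / 2)) := by
  have hLpos : 0 < L := by linarith
  have hKpos : 0 < K := by linarith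
  have hhpos : 0 < h := by linarith
  have hwn : w ≤ 0.071 * n := by
    refine le_of_sq_le_sq (?_ : w ^ 2 ≤ (0.071 * n) ^ 2) (by positivity)
    rw [mul_pow, hn, hw]
    nlinarith
  have hntsq : n * t * (0.92 * h) ≤ K * L := by nlinarith
  have hntK : n * t ≤ K * (1.5 / 0.92) := by
    have : n * t * (0.92 * h) ≤ K * (1.5 / 0.92) * (0.92 * h) := by nlinarith
    exact le_of_mul_le_mul_right this (by positivity)
  have hlog1 : Real.log ((w + n) * t / 11.9) ≤ Real.log K - 1.9 := by
    have e1 : (w + n) * t / 11.9 ≤ K * Real.exp (-1.9) := by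
      have e2 : 1 / 6.8 ≤ Real.exp (-1.9) := by
        rw [Real.exp_neg, ← one_div]
        exact one_div_le_one_div_of_le (Real.exp_pos _) exp_nineteen_tenths_lt.le
      have e3 : w * t ≤ 0.071 * n * t := mul_le_mul_of_nonneg_right hwn ht.le
      have e4 := mul_le_mul_of_nonneg_left e2 hKpos.le
      rw [div_le_iff₀ (by norm_num)]
      linarith
    have e4 := Real.log_le_log (by positivity) e1
    rw [Real.log_mul hKpos.ne' (Real.exp_pos _).ne', Real.log_exp] at e4
    linarith
  have hlogK : Real.log K ≤ K / 200 + 4.55 := by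
    have e1 := Real.log_le_sub_one_of_pos (show 0 < K / 256 by positivity)
    have e2 : Real.log 256 = 8 * Real.log 2 := by
      rw [show (256 : ℝ) = 2 ^ 8 by norm_num, Real.log_pow]; norm_num
    rw [Real.log_div hKpos.ne' (by norm_num), e2] at e1
    have e3 := Real.log_two_lt_d9
    nlinarith
  have hlogN : Real.log (K * L) ≤ 0.056 * K := by
    rw [Real.log_mul hKpos.ne' hLpos.ne']
    have := Real.log_le_log hLpos hLK
    linarith
  have hZ' : Z ≤ 1.0893 * n := by linarith
  have hZsq : Z ^ 2 ≤ 1.18658 * (K * L) := by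
    rw [← hn]
    calc Z ^ 2 ≤ (1.0893 * n) ^ 2 := by gcongr
      _ ≤ _ := by rw [mul_pow]; nlinarith [sq_nonneg n]
  set P := K * L * K / 2 with hP
  have hPpos : 0 < P := by positivity
  have hG : L * n * t * Z ^ 2 / 6 ≤ P * (0.43 * (L ^ 2 / h)) := by
    have e1 : n * t ≤ K * L / (0.92 * h) := by rw [le_div_iff₀ (by positivity)]; exact hntsq
    calc L * n * t * Z ^ 2 / 6 = L / 6 * ((n * t) * Z ^ 2) := by ring
      _ ≤ L / 6 * ((K * L / (0.92 * h)) * (1.18658 * (K * L))) := by gcongr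
      _ = P * ((1.18658 / 2.76) * (L ^ 2 / h)) := by rw [hP]; field_simp; ring
      _ ≤ _ := by gcongr; norm_num
  have hquad : 1.117 ≤ 1.4 * L - h - 0.43 * (L ^ 2 / h) := by
    have : L ^ 2 / h ≤ (1.4 * L - h - 1.117) / 0.43 := by
      rw [div_le_div_iff₀ hhpos (by norm_num)]
      nlinarith [mul_nonneg (sub_nonneg.2 hL) (sub_nonneg.2 hL')]
    rw [le_div_iff₀ (by norm_num)] at this
    linarith
  have hone : 1 ≤ P * 0.0001 := by
    have : 199 * 14 ≤ K * L := mul_le_mul hK (by linarith) (by norm_num) hKpos.le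
    rw [hP]
    nlinarith
  have hNK : K * L ≤ P * 0.0101 := by
    rw [hP]
    have : 0 < K * L := by positivity
    nlinarith
  have hNlog : K * L * Real.log (K * L) ≤ P * 0.112 := by
    have := mul_le_mul_of_nonneg_left hlogN (show 0 ≤ K * L by positivity)
    rw [hP]; linarith
  have hy := mul_le_mul_of_nonneg_left hlog1 hPpos.le
  have hq := mul_le_mul_of_nonneg_left hquad hPpos.le
  have e7 : 1.6 * (7 * (K * L / 4) ^ 2 - 2 * (K * L / 4)) = P * (1.4 * L) - 0.8 * (K * L) := by
    rw [hP]; ring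
  have e8 : L * (K ^ 2 / 2 * (Real.log K - 3 / 2)) = P * (Real.log K - 3 / 2) := by rw [hP]; ring
  rw [e7, e8]
  linarith

theorem exp_eight_fifths_bounds : 4.95 ≤ Real.exp 1.6 ∧ Real.exp 1.6 ≤ 4.9531 := by
  have e1 := Real.exp_one_lt_d9
  have e2 := Real.exp_one_gt_d9
  have e3 : Real.exp 1.6 ^ 5 = Real.exp 1 ^ 8 := by
    rw [← Real.exp_nat_mul, ← Real.exp_nat_mul]
    norm_num
  constructor
  · refine le_of_pow_le_pow_left₀ (n := 5) (by norm_num) (Real.exp_pos _).le ?_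
    rw [e3]
    calc (4.95 : ℝ) ^ 5 ≤ 2.7182818283 ^ 8 := by norm_num
      _ ≤ _ := by gcongr
  · refine le_of_pow_le_pow_left₀ (n := 5) (by norm_num) (by norm_num) ?_
    rw [e3]
    calc Real.exp 1 ^ 8 ≤ 2.7182818286 ^ 8 := by gcongr
      _ ≤ _ := by norm_num

theorem exists_interp_parameters {h t : ℝ} (hh : 10 ≤ h) (ht : 5.95 ≤ t) :
    ∃ L κ : ℕ, 1.4 * h ≤ L ∧ (L : ℝ) ≤ 1.5 * h ∧ (L : ℝ) ≤ 4 * κ ∧ (199 : ℝ) ≤ 4 * κ ∧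
      (0.92 * h * t) ^ 2 ≤ 4 * κ * L ∧ (4 * κ * L : ℝ) ≤ 0.8464 * (h * t) ^ 2 + 6 * h := by
  have hL0 : 0 ≤ 1.4 * h := by linarith
  have hL1 := Nat.le_ceil (1.4 * h)
  have hL2 := (Nat.ceil_lt_add_one hL0).le
  set L := ⌈1.4 * h⌉₊
  have hLpos : (0 : ℝ) < L := by linarith
  have hL3 : (L : ℝ) ≤ 1.5 * h := by linarith
  have hκ0 : 0 ≤ 0.8464 * (h * t) ^ 2 / (4 * L) := by positivity
  have hκ1 := Nat.le_ceil (0.8464 * (h * t) ^ 2 / (4 * L))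
  have hκ2 := (Nat.ceil_lt_add_one hκ0).le
  set κ := ⌈0.8464 * (h * t) ^ 2 / (4 * L)⌉₊
  rw [div_le_iff₀ (by positivity)] at hκ1
  have hκ3 : κ * (4 * L : ℝ) ≤ 0.8464 * (h * t) ^ 2 + 4 * L := by
    have := mul_le_mul_of_nonneg_right hκ2 (show (0 : ℝ) ≤ 4 * L by positivity)
    rwa [add_mul, div_mul_cancel₀ _ (by positivity), one_mul] at this
  have hbig : 19.97 * h ≤ 4 * κ := by
    have e1 : 29.964 * h ^ 2 ≤ 0.8464 * (h * t) ^ 2 := by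
      have : (5.95 : ℝ) ^ 2 ≤ t ^ 2 := by gcongr
      rw [mul_pow]
      nlinarith [sq_nonneg h]
    have e2 : (κ : ℝ) * (4 * L) ≤ κ * (4 * (1.5 * h)) := by gcongr
    have e3 : 29.964 * h * h ≤ 6 * κ * h := by nlinarith
    have := le_of_mul_le_mul_right e3 (by linarith)
    linarith
  refine ⟨L, κ, hL1, hL3, by linarith, by linarith, ?_, by linarith⟩
  nlinarith

/-- A positive difference of logarithms of powers of rationals is not too small. -/
theorem exp_neg_le_mul_log_sub {p₁ q₁ p₂ q₂ : ℕ} (hq₁ : 0 < q₁) (hp₁ : q₁ < p₁) (hq₂ : 0 < q₂)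
    (hp₂ : q₂ < p₂) (u v : ℕ)
    (hpos : 0 < v * (Real.log p₂ - Real.log q₂) - u * (Real.log p₁ - Real.log q₁)) :
    Real.exp (-(v * Real.log p₂ + u * Real.log p₁)) ≤
      v * (Real.log p₂ - Real.log q₂) - u * (Real.log p₁ - Real.log q₁) := by
  have c1 : (0 : ℝ) < q₁ := by exact_mod_cast hq₁
  have c2 : (0 : ℝ) < q₂ := by exact_mod_cast hq₂
  have c3 : (q₁ : ℝ) < p₁ := by exact_mod_cast hp₁
  have c4 : (q₂ : ℝ) < p₂ := by exact_mod_cast hp₂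
  have c5 := c1.trans c3
  have c6 := c2.trans c4
  have hP : (0 : ℝ) < p₂ ^ v * q₁ ^ u := by positivity
  have hQ : (0 : ℝ) < q₂ ^ v * p₁ ^ u := by positivity
  have e1 : v * (Real.log p₂ - Real.log q₂) - u * (Real.log p₁ - Real.log q₁) =
      Real.log (p₂ ^ v * q₁ ^ u : ℝ) - Real.log (q₂ ^ v * p₁ ^ u : ℝ) := by
    rw [Real.log_mul (by positivity) (by positivity), Real.log_mul (by positivity) (by positivity)]
    simp only [Real.log_pow]
    ring
  rw [e1] at hpos ⊢
  have hlt : (q₂ ^ v * p₁ ^ u : ℝ) + 1 ≤ p₂ ^ v * q₁ ^ u := by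
    have : (q₂ ^ v * p₁ ^ u : ℝ) < p₂ ^ v * q₁ ^ u := by
      rwa [sub_pos, Real.log_lt_log_iff hQ hP] at hpos
    exact_mod_cast this
  have e2 := Real.one_sub_inv_le_log_of_pos (div_pos hP hQ)
  rw [Real.log_div hP.ne' hQ.ne', inv_div] at e2
  refine le_trans ?_ e2
  have e3 : (p₂ ^ v * q₁ ^ u : ℝ)⁻¹ ≤ 1 - (q₂ ^ v * p₁ ^ u : ℝ) / (p₂ ^ v * q₁ ^ u) := by
    rw [le_sub_iff_add_le, ← one_div, ← add_div, div_le_one hP]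
    linarith
  refine le_trans ?_ e3
  rw [Real.exp_neg]
  refine inv_anti₀ hP ?_
  rw [Real.exp_add, mul_comm (v : ℝ), mul_comm (u : ℝ), Real.exp_mul, Real.exp_mul,
    Real.exp_log c6, Real.exp_log c5, Real.rpow_natCast, Real.rpow_natCast]
  gcongr

/-- The case in which `r b₂ + s b₁` fails to be injective on a box. -/
theorem exp_neg_le_linear_form_of_not_injOn {p₁ q₁ p₂ q₂ b₁ b₂ R S : ℕ} {l₁ l₂ X : ℝ} (hq₁ : 0 < q₁)
    (hp₁ : q₁ < p₁) (hq₂ : 0 < q₂) (hp₂ : q₂ < p₂) (hb₁ : 0 < b₁) (hb₂ : 0 < b₂)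
    (hl₁ : Real.log p₁ ≤ l₁) (hl₂ : Real.log p₂ ≤ l₂) (hl₁' : 0 ≤ l₁) (hl₂' : 1 ≤ l₂)
    (hR : ((R : ℝ) - 1) * l₁ ≤ X) (hS : ((S : ℝ) - 1) * l₂ ≤ X)
    (hΛ : 0 < b₂ * (Real.log p₂ - Real.log q₂) - b₁ * (Real.log p₁ - Real.log q₁))
    (hinj : ¬ Set.InjOn (fun p : ℕ × ℕ => (p.1 * (b₂ : ℝ) + p.2 * (b₁ : ℝ) : ℝ))
      (Finset.range R ×ˢ Finset.range S : Finset (ℕ × ℕ))) :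
    Real.exp (-(3 * X)) ≤
      b₂ * (Real.log p₂ - Real.log q₂) - b₁ * (Real.log p₁ - Real.log q₁) := by
  have hb₁' : (0 : ℝ) < b₁ := by exact_mod_cast hb₁
  have hb₂' : (0 : ℝ) < b₂ := by exact_mod_cast hb₂
  obtain ⟨u, v, hu, hv, hv0, huv⟩ : ∃ u v : ℕ, u < R ∧ v < S ∧ 0 < v ∧ u * b₂ = v * b₁ := by
    simp only [Set.InjOn, not_forall] at hinj
    obtain ⟨⟨r, s⟩, h1, ⟨r', s'⟩, h2, heq, hne⟩ := hinj
    simp only [Finset.coe_product, Finset.coe_range, Set.mem_prod, Set.mem_Iio] at h1 h2 heq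
    have heq' : r * b₂ + s * b₁ = r' * b₂ + s' * b₁ := by exact_mod_cast heq
    rcases lt_trichotomy s s' with hs | hs | hs
    · refine ⟨r - r', s' - s, by omega, by omega, by omega, ?_⟩
      have hr : r' ≤ r := by
        by_contra! hlt
        nlinarith
      zify [hs.le, hr]; zify at heq'; linarith
    · subst hs
      have : r = r' := Nat.eq_of_mul_eq_mul_right hb₂ (by omega)
      exact absurd (by rw [this]) hne
    · refine ⟨r' - r, s - s', by omega, by omega, by omega, ?_⟩
      have hr : r ≤ r' := by
        by_contra! hlt
        nlinarith
      zify [hs.le, hr]; zify at heq'; linarith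
  have hv0' : (0 : ℝ) < v := by exact_mod_cast hv0
  have huv' : (u : ℝ) * b₂ = v * b₁ := by exact_mod_cast huv
  have hscale : b₂ * (v * (Real.log p₂ - Real.log q₂) - u * (Real.log p₁ - Real.log q₁)) =
      v * (b₂ * (Real.log p₂ - Real.log q₂) - b₁ * (Real.log p₁ - Real.log q₁)) := by
    linear_combination (-(Real.log p₁ - Real.log q₁)) * huv'
  have hpos : 0 < v * (Real.log p₂ - Real.log q₂) - u * (Real.log p₁ - Real.log q₁) := by
    have : 0 < b₂ * (v * (Real.log p₂ - Real.log q₂) - u * (Real.log p₁ - Real.log q₁)) := by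
      rw [hscale]; positivity
    exact pos_of_mul_pos_right this hb₂'.le
  have h1 := exp_neg_le_mul_log_sub hq₁ hp₁ hq₂ hp₂ u v hpos
  have hul : u * Real.log p₁ ≤ X := by
    have : (u : ℝ) ≤ R - 1 := by rw [le_sub_iff_add_le]; exact_mod_cast hu
    calc u * Real.log p₁ ≤ u * l₁ := by gcongr
      _ ≤ (R - 1) * l₁ := by gcongr
      _ ≤ X := hR
  have hvS : (v : ℝ) ≤ S - 1 := by rw [le_sub_iff_add_le]; exact_mod_cast hv
  have hvl' : v * l₂ ≤ X := le_trans (by gcongr) hS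
  have hvl : v * Real.log p₂ ≤ X := le_trans (by gcongr) hvl'
  have hvX : (v : ℝ) ≤ X := by nlinarith
  have h2 : (v : ℝ) ≤ Real.exp X := hvX.trans (by linarith [Real.add_one_le_exp X])
  have h3 : Real.exp (-(2 * X)) ≤
      v * (Real.log p₂ - Real.log q₂) - u * (Real.log p₁ - Real.log q₁) :=
    le_trans (Real.exp_le_exp.2 (by linarith)) h1
  have h4 : Real.exp (-(2 * X)) ≤
      v * (b₂ * (Real.log p₂ - Real.log q₂) - b₁ * (Real.log p₁ - Real.log q₁)) := by
    rw [← hscale]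
    refine h3.trans (le_mul_of_one_le_left hpos.le ?_)
    exact_mod_cast hb₂
  have h5 : Real.exp (-(3 * X)) * Real.exp X = Real.exp (-(2 * X)) := by
    rw [← Real.exp_add]; ring_nf
  refine le_of_mul_le_mul_right ?_ (Real.exp_pos X)
  rw [h5]
  refine h4.trans ?_
  rw [mul_comm]
  exact mul_le_mul_of_nonneg_left h2 hΛ.le

theorem pow_four_le_exp {q : ℝ} (hq : 100 ≤ q) : q ^ 4 ≤ Real.exp (0.72 * q) := by
  have h1 : q ≤ Real.exp (0.06 * q) ^ 3 := by
    calc q ≤ (0.06 * q) ^ 3 := by nlinarith [mul_le_mul hq hq (by norm_num) (by linarith)]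
      _ ≤ _ := by
        gcongr
        linarith [Real.add_one_le_exp (0.06 * q)]
  calc q ^ 4 ≤ (Real.exp (0.06 * q) ^ 3) ^ 4 := by gcongr
    _ = Real.exp (0.72 * q) := by
      rw [← pow_mul, ← Real.exp_nat_mul]
      congr 1; push_cast; ring

theorem mul_le_of_sq_le {q n t : ℝ} (hq : 0 ≤ q) (hn : n ^ 2 ≤ 30.6 * q)
    (ht : t ^ 2 ≤ 0.36 * q) : n * t ≤ 3.33 * q := by
  refine le_of_sq_le_sq (?_ : (n * t) ^ 2 ≤ (3.33 * q) ^ 2) (by positivity)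
  have : n ^ 2 * t ^ 2 ≤ (30.6 * q) * (0.36 * q) := mul_le_mul hn ht (sq_nonneg t) (by positivity)
  nlinarith

theorem interp_size_le {q L N n t R S g : ℝ} (hq : 100 ≤ q) (hL0 : 0 ≤ L) (hL : L ≤ 0.15 * q)
    (hn : n ^ 2 = N) (hN : N ≤ 30.6 * q) (ht : t ^ 2 ≤ 0.36 * q)
    (hR0 : 0 ≤ R) (hS0 : 0 ≤ S)
    (hR : (R - 1) * 5.95 ≤ 2 * n * t) (hS : (S - 1) * 5.95 ≤ 2 * n * t)
    (hg : g = L / 12 * √(N * R * S)) : S * g ≤ q ^ 4 := by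
  have hnt : n * t ≤ 3.33 * q := mul_le_of_sq_le (by linarith) (hn.trans_le hN) ht
  have hR' : R ≤ 1.2 * q := by linarith
  have hS' : S ≤ 1.2 * q := by linarith
  have hsq : √(N * R * S) ≤ q ^ 2 := by
    rw [Real.sqrt_le_iff]
    refine ⟨by positivity, ?_⟩
    have hN0 : 0 ≤ N := hn ▸ sq_nonneg n
    calc N * R * S ≤ (30.6 * q) * (1.2 * q) * (1.2 * q) := by gcongr
      _ ≤ (q ^ 2) ^ 2 := by nlinarith [pow_pos (show 0 < q by linarith) 3]
  have hq0 : 0 < q := by linarith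
  calc S * g ≤ (1.2 * q) * (0.15 * q / 12 * q ^ 2) := by
        rw [hg]
        gcongr
    _ ≤ q ^ 4 := by nlinarith [pow_pos hq0 4]

theorem exists_box {a₁ a₂ t c : ℝ} (ha₁ : 0 < a₁) (ha₂ : 0 < a₂) (ht : 0 < t)
    (hta : t ^ 2 = a₁ * a₂) (hc : 0 ≤ c) :
    ∃ R S : ℕ, 1 ≤ R ∧ 1 ≤ S ∧ ((R : ℝ) - 1) * a₁ ≤ c * t ∧ ((S : ℝ) - 1) * a₂ ≤ c * t ∧
      c ^ 2 < R * S := by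
  have h1 := Nat.floor_le (show 0 ≤ c * t / a₁ by positivity)
  have h2 := Nat.floor_le (show 0 ≤ c * t / a₂ by positivity)
  have h3 := Nat.lt_floor_add_one (c * t / a₁)
  have h4 := Nat.lt_floor_add_one (c * t / a₂)
  refine ⟨⌊c * t / a₁⌋₊ + 1, ⌊c * t / a₂⌋₊ + 1, by omega, by omega, ?_, ?_, ?_⟩
  · push_cast
    rwa [add_sub_cancel_right, ← le_div_iff₀ ha₁]
  · push_cast
    rwa [add_sub_cancel_right, ← le_div_iff₀ ha₂]
  · have h5 : c ^ 2 = (c * t / a₁) * (c * t / a₂) := by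
      field_simp
      rw [hta, mul_assoc]
    push_cast
    rw [h5]
    exact mul_lt_mul'' h3 h4 (by positivity) (by positivity)

theorem mul_log_sub_add_le {ρ l : ℝ} {p q : ℕ} (hρ : 1 ≤ ρ) (hl : Real.log p ≤ l) :
    ρ * (Real.log p - Real.log q) + (Real.log p + Real.log q) ≤ (ρ + 1) * l := by
  have := Real.log_natCast_nonneg q
  nlinarith

theorem add_mul_add_le_sq (X a b : ℝ) : (X + a) * (X + b) ≤ (X + (a + b) / 2) ^ 2 := by
  nlinarith [sq_nonneg (a - b)]

theorem add_le_mul_of_le {a b : ℝ} (ha : 5.95 ≤ a) (hb : 5.95 ≤ b) : a + b ≤ 0.3367 * (a * b) := by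
  nlinarith [mul_nonneg (sub_nonneg.2 ha) (sub_nonneg.2 hb)]

/-- With the parameters chosen for Laurent's bound the interpolation inequality fails. -/
theorem interp_inequality_lt {K L R S b₁ b₂ : ℕ} {ρ l₁ l₂ a₁ a₂ t h w n g B y₁ y₂ : ℝ}
    (hρ : 4.95 ≤ ρ) (hl₁ : 1 ≤ l₁) (hl₂ : 1 ≤ l₂) (ha₁ : a₁ = (ρ + 1) * l₁)
    (ha₂ : a₂ = (ρ + 1) * l₂) (ht : 5.95 ≤ t) (htsq : t ^ 2 = a₁ * a₂) (hh : 10 ≤ h)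
    (hL₁ : 1.4 * h ≤ L) (hL₂ : (L : ℝ) ≤ 1.5 * h) (hLK : (L : ℝ) ≤ K) (hK : (199 : ℝ) ≤ K)
    (hw0 : 0 ≤ w) (hw : w ^ 2 = L) (hn0 : 0 < n) (hn : n ^ 2 = K * L) (hnt : 0.92 * h * t ≤ n)
    (hR : ((R : ℝ) - 1) * a₁ ≤ (w + n) * t) (hS : ((S : ℝ) - 1) * a₂ ≤ (w + n) * t)
    (hg : g = L / 12 * √(K * L * R * S))
    (hB : B = (((R : ℝ) - 1) * b₂ + ((S : ℝ) - 1) * b₁) / 2) (hBpos : 0 < B)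
    (hb₁ : 0 < b₁) (hb : Real.log (b₁ / l₂ + b₂ / l₁) + 0.38 ≤ h)
    (hy₁ : y₁ ≤ a₁) (hy₂ : y₂ ≤ a₂) :
    Real.log ((K * L).factorial) + K * L * (K - 1) / 2 * (1.6 + Real.log B) +
        R * g * y₁ + S * g * y₂ + 1 <
      1.6 * (7 * (K * L / 4 : ℝ) ^ 2 - 2 * (K * L / 4)) +
        L * ∑ k ∈ Finset.range K, Real.log (k.factorial) := by
  have hl₁0 : 0 < l₁ := by linarith
  have hl₂0 : 0 < l₂ := by linarith
  have hal₁ : l₁ * 5.95 ≤ a₁ := by rw [ha₁, mul_comm]; gcongr; linarith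
  have hal₂ : l₂ * 5.95 ≤ a₂ := by rw [ha₂, mul_comm]; gcongr; linarith
  have ha₁0 : 0 < a₁ := by linarith
  have ha₂0 : 0 < a₂ := by linarith
  have ht0 : 0 < t := by linarith
  have h10 : 9.2 * t ≤ n := by
    have : 10 * t ≤ h * t := by gcongr
    linarith
  have hB' : Real.log B ≤ h - 0.38 + Real.log ((w + n) * t / 11.9) := by
    have hpos : 0 < (b₁ : ℝ) / l₂ + b₂ / l₁ := by positivity
    have hR1 : (R : ℝ) - 1 ≤ (w + n) * t / 5.95 / l₁ := by
      rcases le_total 0 ((R : ℝ) - 1) with h0 | h0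
      · rw [le_div_iff₀ hl₁0, le_div_iff₀ (by norm_num), mul_assoc]
        exact (mul_le_mul_of_nonneg_left hal₁ h0).trans hR
      · exact h0.trans (by positivity)
    have hS1 : (S : ℝ) - 1 ≤ (w + n) * t / 5.95 / l₂ := by
      rcases le_total 0 ((S : ℝ) - 1) with h0 | h0
      · rw [le_div_iff₀ hl₂0, le_div_iff₀ (by norm_num), mul_assoc]
        exact (mul_le_mul_of_nonneg_left hal₂ h0).trans hS
      · exact h0.trans (by positivity)
    have e1 : B ≤ (b₁ / l₂ + b₂ / l₁) * ((w + n) * t / 11.9) := by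
      calc B ≤ ((w + n) * t / 5.95 / l₁ * b₂ + (w + n) * t / 5.95 / l₂ * b₁) / 2 := by
            rw [hB]; gcongr
        _ = _ := by field_simp; ring
    have e2 := Real.log_le_log hBpos e1
    rw [Real.log_mul hpos.ne' (by positivity)] at e2
    linarith
  obtain ⟨Z, hZ⟩ : ∃ Z, Z = w + n + (a₁ + a₂) / (2 * t) := ⟨_, rfl⟩
  have hZ0 : 0 ≤ Z := by rw [hZ]; positivity
  have hZn : Z ≤ w + n + 0.0183 * n := by
    rw [hZ]; gcongr
    rw [div_le_iff₀ (by positivity)]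
    have e1 : 0.0183 * (9.2 * t) * (2 * t) ≤ 0.0183 * n * (2 * t) := by gcongr
    have e2 : 0.0183 * (9.2 * t) * (2 * t) = 0.33672 * (a₁ * a₂) := by rw [← htsq]; ring
    have e3 := add_le_mul_of_le (a := a₁) (b := a₂) (by linarith) (by linarith)
    have e4 : 0 < a₁ * a₂ := by positivity
    linarith
  have htZ : t * Z = (w + n) * t + (a₁ + a₂) / 2 := by rw [hZ]; field_simp
  have hsqrt : √(K * L * R * S) ≤ n * Z := by
    rw [Real.sqrt_le_iff]
    refine ⟨by positivity, ?_⟩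
    have e1 : (R * S : ℝ) * t ^ 2 ≤ Z ^ 2 * t ^ 2 := by
      calc (R * S : ℝ) * t ^ 2 = (R * a₁) * (S * a₂) := by rw [htsq]; ring
        _ ≤ ((w + n) * t + a₁) * ((w + n) * t + a₂) := by
            gcongr <;> linarith
        _ ≤ (t * Z) ^ 2 := by rw [htZ]; exact add_mul_add_le_sq _ _ _
        _ = _ := by ring
    have e2 := le_of_mul_le_mul_right e1 (by positivity)
    rw [mul_pow, hn, mul_assoc]
    gcongr
  have hg0 : 0 ≤ g := by rw [hg]; positivity
  have hGb : R * g * y₁ + S * g * y₂ ≤ L * n * t * Z ^ 2 / 6 := by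
    calc _ ≤ R * g * a₁ + S * g * a₂ := by gcongr
      _ = g * (R * a₁ + S * a₂) := by ring
      _ ≤ (L / 12 * (n * Z)) * (2 * (t * Z)) := by
          rw [hg]; gcongr; rw [htZ]; linarith
      _ = _ := by ring
  have hcontra := interp_parameters_contradict hh hL₁ hL₂ hK hLK hw hw0 hn hn0 ht0 hnt hZ0 hZn
  have hfact := log_factorial_le_mul_log (K * L)
  push_cast at hfact
  have hst := mul_le_mul_of_nonneg_left (sq_mul_log_sub_le_sum_log_factorial K)
    (Nat.cast_nonneg (α := ℝ) L)
  have hy0 : 0 ≤ Real.log ((w + n) * t / 11.9) := by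
    refine Real.log_nonneg ?_
    rw [le_div_iff₀ (by norm_num)]
    have : 2 * 5.95 ≤ (w + n) * t := by gcongr; linarith
    linarith
  have hy : (K * L * (K - 1) / 2 : ℝ) * (1.6 + Real.log B) ≤
      K * L * K / 2 * (1.6 + (h - 0.38 + Real.log ((w + n) * t / 11.9))) := by
    have e0 : (0 : ℝ) ≤ K - 1 := by linarith
    have e1 : (0 : ℝ) ≤ K * L * (K - 1) / 2 := by positivity
    refine (mul_le_mul_of_nonneg_left (add_le_add_right hB' 1.6) e1).trans ?_
    refine mul_le_mul_of_nonneg_right ?_ (by linarith)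
    gcongr; linarith
  linarith

set_option maxHeartbeats 2000000 in
/-- Laurent's bound for a positive linear form in the logarithms of two rationals greater than
one. -/
theorem exp_neg_le_linear_form {p₁ q₁ p₂ q₂ b₁ b₂ : ℕ} {x₁ x₂ l₁ l₂ h : ℝ} (hq₁ : 0 < q₁)
    (hp₁ : q₁ < p₁) (hq₂ : 0 < q₂) (hp₂ : q₂ < p₂) (hb₁ : 0 < b₁) (hb₂ : 0 < b₂)
    (hx₁ : x₁ = Real.log p₁ - Real.log q₁) (hx₂ : x₂ = Real.log p₂ - Real.log q₂)
    (hl₁ : Real.log p₁ ≤ l₁) (hl₂ : Real.log p₂ ≤ l₂) (hl₁' : 1 ≤ l₁) (hl₂' : 1 ≤ l₂)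
    (hindep : ∀ a b : ℤ, a * x₁ = b * x₂ → a = 0 ∧ b = 0) (hh : 10 ≤ h)
    (hb : Real.log (b₁ / l₂ + b₂ / l₁) + 0.38 ≤ h) (hΛ : 0 < b₂ * x₂ - b₁ * x₁) :
    Real.exp (-(25.2 * (h ^ 2 * l₁ * l₂))) ≤ b₂ * x₂ - b₁ * x₁ := by
  by_contra! hcon
  obtain ⟨hρ₁, hρ₂⟩ := exp_eight_fifths_bounds
  have hl₁0 : 0 < l₁ := by linarith
  have hl₂0 : 0 < l₂ := by linarith
  obtain ⟨a₁, ha₁⟩ : ∃ a₁, a₁ = (Real.exp 1.6 + 1) * l₁ := ⟨_, rfl⟩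
  obtain ⟨a₂, ha₂⟩ : ∃ a₂, a₂ = (Real.exp 1.6 + 1) * l₂ := ⟨_, rfl⟩
  have hal₁ : l₁ * 5.95 ≤ a₁ := by rw [ha₁, mul_comm]; gcongr; linarith
  have hal₂ : l₂ * 5.95 ≤ a₂ := by rw [ha₂, mul_comm]; gcongr; linarith
  have ha₁' : 5.95 ≤ a₁ := by linarith
  have ha₂' : 5.95 ≤ a₂ := by linarith
  have ha₁0 : 0 < a₁ := by linarith
  have ha₂0 : 0 < a₂ := by linarith
  obtain ⟨t, ht0, htsq⟩ : ∃ t : ℝ, 0 ≤ t ∧ t ^ 2 = a₁ * a₂ :=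
    ⟨√(a₁ * a₂), Real.sqrt_nonneg _, Real.sq_sqrt (by positivity)⟩
  have ht : 5.95 ≤ t := by
    refine le_of_sq_le_sq (?_ : (5.95 : ℝ) ^ 2 ≤ t ^ 2) ht0
    rw [htsq, sq]
    exact mul_le_mul ha₁' ha₂' (by norm_num) ha₁0.le
  obtain ⟨q, hq⟩ : ∃ q, q = h ^ 2 * l₁ * l₂ := ⟨_, rfl⟩
  have hll : 1 ≤ l₁ * l₂ := one_le_mul_of_one_le_of_one_le hl₁' hl₂'
  have hh100 : 10 * h ≤ h ^ 2 := by nlinarith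
  have hqh : h ^ 2 ≤ q := by
    rw [hq, mul_assoc]; exact le_mul_of_one_le_right (sq_nonneg h) hll
  have hq100 : 100 ≤ q := by linarith
  have hρsq : (Real.exp 1.6 + 1) ^ 2 ≤ 35.44 := by nlinarith
  have htll : t ^ 2 = (Real.exp 1.6 + 1) ^ 2 * (l₁ * l₂) := by rw [htsq, ha₁, ha₂]; ring
  have hht : (h * t) ^ 2 ≤ 35.44 * q := by
    have : (h * t) ^ 2 = (Real.exp 1.6 + 1) ^ 2 * q := by rw [mul_pow, htll, hq]; ring
    rw [this]; gcongr
  have ht36 : t ^ 2 ≤ 0.36 * q := by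
    have e1 : 100 * (l₁ * l₂) ≤ q := by
      rw [hq, mul_assoc]; gcongr; linarith
    have e2 := mul_le_mul_of_nonneg_right hρsq (zero_le_one.trans hll)
    rw [htll]
    linarith
  obtain ⟨L, κ, hL1, hL2, hL3, hκ, hN1, hN2⟩ := exists_interp_parameters hh ht
  obtain ⟨K, hK⟩ : ∃ K, K = 4 * κ := ⟨_, rfl⟩
  have hKr : (4 * κ : ℝ) = K := by rw [hK]; push_cast; ring
  rw [hKr] at hL3 hκ hN1 hN2
  have hLpos : (0 : ℝ) < L := by linarith
  have hK1 : (1 : ℝ) ≤ K := by linarith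
  have hLpos' : 0 < L := by exact_mod_cast hLpos
  have hKpos' : 0 < K := by exact_mod_cast hK1
  obtain ⟨w, hw0, hw⟩ : ∃ w : ℝ, 0 ≤ w ∧ w ^ 2 = L :=
    ⟨√L, Real.sqrt_nonneg _, Real.sq_sqrt hLpos.le⟩
  obtain ⟨n, hn0, hn⟩ : ∃ n : ℝ, 0 ≤ n ∧ n ^ 2 = K * L :=
    ⟨√(K * L), Real.sqrt_nonneg _, Real.sq_sqrt (by positivity)⟩
  obtain ⟨μ, hμ0, hμ⟩ : ∃ μ : ℝ, 0 ≤ μ ∧ μ ^ 2 = (K - 1) * L :=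
    ⟨√((K - 1) * L), Real.sqrt_nonneg _, Real.sq_sqrt (mul_nonneg (by linarith) hLpos.le)⟩
  have hμn : μ ≤ n := le_of_sq_le_sq (by rw [hμ, hn]; gcongr; linarith) hn0
  have hwn : w ≤ n :=
    le_of_sq_le_sq (by rw [hw, hn]; exact le_mul_of_one_le_left hLpos.le hK1) hn0
  have hnt : 0.92 * h * t ≤ n := le_of_sq_le_sq (by rw [hn]; exact hN1) hn0
  have ht0' : 0 < t := by linarith
  have hn0' : 0 < n := lt_of_lt_of_le (by positivity) hnt
  obtain ⟨R₁, S₁, hR₁, hS₁, hR₁t, hS₁t, hbox₁⟩ := exists_box ha₁0 ha₂0 ht0' htsq hw0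
  obtain ⟨R₂, S₂, hR₂, hS₂, hR₂t, hS₂t, hbox₂⟩ := exists_box ha₁0 ha₂0 ht0' htsq hμ0
  rw [hw] at hbox₁
  rw [hμ] at hbox₂
  have hμt : μ * t ≤ n * t := by gcongr
  have hwt : w * t ≤ n * t := by gcongr
  have hLq : (L : ℝ) ≤ 0.15 * q := by linarith
  have hNq : (K * L : ℝ) ≤ 30.6 * q := by linarith
  have hR₁r : (1 : ℝ) ≤ R₁ := by exact_mod_cast hR₁
  have hS₁r : (1 : ℝ) ≤ S₁ := by exact_mod_cast hS₁
  have hR₂r : (1 : ℝ) ≤ R₂ := by exact_mod_cast hR₂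
  have hS₂r : (1 : ℝ) ≤ S₂ := by exact_mod_cast hS₂
  have hβ : Set.InjOn (fun p : ℕ × ℕ => (p.1 * (b₂ : ℝ) + p.2 * (b₁ : ℝ) : ℝ))
      (Finset.range R₂ ×ˢ Finset.range S₂ : Finset (ℕ × ℕ)) := by
    by_contra hni
    have hXR : ((R₂ : ℝ) - 1) * l₁ ≤ n * t / 5.95 := by
      rw [le_div_iff₀ (by norm_num), mul_assoc]
      exact (mul_le_mul_of_nonneg_left hal₁ (sub_nonneg.2 hR₂r)).trans (hR₂t.trans hμt)
    have hXS : ((S₂ : ℝ) - 1) * l₂ ≤ n * t / 5.95 := by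
      rw [le_div_iff₀ (by norm_num), mul_assoc]
      exact (mul_le_mul_of_nonneg_left hal₂ (sub_nonneg.2 hS₂r)).trans (hS₂t.trans hμt)
    have h1 := exp_neg_le_linear_form_of_not_injOn hq₁ hp₁ hq₂ hp₂ hb₁ hb₂ hl₁ hl₂ hl₁0.le hl₂'
      hXR hXS (by rw [← hx₁, ← hx₂]; exact hΛ) hni
    rw [← hx₁, ← hx₂] at h1
    have h2 := Real.exp_lt_exp.1 (h1.trans_lt hcon)
    rw [← hq] at h2
    have h3 : n * t ≤ 3.33 * q := mul_le_of_sq_le (by linarith) (hn.trans_le hNq) ht36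
    have h4 : n * t / 5.95 ≤ q := by
      rw [div_le_iff₀ (by norm_num)]; linarith only [h3, hq100]
    linarith only [h2, h4, hq100]
  have hxinj : Function.Injective fun p : ℕ × ℕ => (p.1 * x₁ + p.2 * x₂ : ℝ) := by
    rintro ⟨r, s⟩ ⟨r', s'⟩ heq
    simp only at heq
    obtain ⟨e1, e2⟩ := hindep ((r : ℤ) - r') ((s' : ℤ) - s) (by push_cast; linarith)
    ext <;> simp only <;> omega
  obtain ⟨R, hR⟩ : ∃ R, R = R₁ + R₂ - 1 := ⟨_, rfl⟩
  obtain ⟨S, hS⟩ : ∃ S, S = S₁ + S₂ - 1 := ⟨_, rfl⟩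
  have hRr : (R : ℝ) = R₁ + R₂ - 1 := by
    rw [hR, Nat.cast_sub (by omega)]; push_cast; ring
  have hSr : (S : ℝ) = S₁ + S₂ - 1 := by
    rw [hS, Nat.cast_sub (by omega)]; push_cast; ring
  have hRY : ((R : ℝ) - 1) * a₁ ≤ (w + n) * t := by rw [hRr]; linarith
  have hSY : ((S : ℝ) - 1) * a₂ ≤ (w + n) * t := by rw [hSr]; linarith
  have hR1 : (1 : ℝ) ≤ R := by linarith
  have hS1 : (1 : ℝ) ≤ S := by linarith
  obtain ⟨g, hg⟩ : ∃ g : ℝ, g = L / 12 * √(K * L * R * S) := ⟨_, rfl⟩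
  have hg0 : 0 ≤ g := by rw [hg]; positivity
  obtain ⟨B, hB⟩ : ∃ B : ℝ, B = (((R : ℝ) - 1) * b₂ + ((S : ℝ) - 1) * b₁) / 2 := ⟨_, rfl⟩
  have hb₁' : (0 : ℝ) < b₁ := by exact_mod_cast hb₁
  have hb₂' : (0 : ℝ) < b₂ := by exact_mod_cast hb₂
  have hBpos : 0 < B := by
    have e3 : 1 < (R : ℝ) ∨ 1 < (S : ℝ) := by
      by_contra! hle
      have : (R₁ * S₁ : ℝ) ≤ 1 :=
        mul_le_one₀ (by linarith) (Nat.cast_nonneg _) (by linarith)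
      linarith
    rw [hB]
    rcases e3 with e3 | e3
    · have := mul_pos (sub_pos.2 e3) hb₂'
      have := mul_nonneg (sub_nonneg.2 hS1) hb₁'.le
      linarith
    · have := mul_pos (sub_pos.2 e3) hb₁'
      have := mul_nonneg (sub_nonneg.2 hR1) hb₂'.le
      linarith
  have hMr : (((κ * L : ℕ) : ℝ)) = K * L / 4 := by rw [← hKr]; push_cast; ring
  have hSg : S * g ≤ q ^ 4 := by
    refine interp_size_le hq100 hLpos.le hLq hn hNq ht36 (by linarith) (by linarith) ?_ ?_ hg
    · have := mul_le_mul_of_nonneg_left ha₁' (sub_nonneg.2 hR1)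
      linarith
    · have := mul_le_mul_of_nonneg_left ha₂' (sub_nonneg.2 hS1)
      linarith
  have hsmall : Real.exp (1.6 * (2 * ((κ * L : ℕ) : ℝ))) *
      ((b₂ * x₂ - b₁ * x₁) / b₂ * (S * g)) ≤ 1 := by
    have e1 : (b₂ * x₂ - b₁ * x₁) / b₂ ≤ Real.exp (-(25.2 * q)) := by
      refine (div_le_self hΛ.le (by exact_mod_cast hb₂)).trans ?_
      rw [hq]; exact hcon.le
    have e2 : 1.6 * (2 * ((κ * L : ℕ) : ℝ)) ≤ 24.48 * q := by rw [hMr]; linarith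
    calc _ ≤ Real.exp (24.48 * q) * (Real.exp (-(25.2 * q)) * Real.exp (0.72 * q)) := by
          gcongr
          exact hSg.trans (pow_four_le_exp hq100)
      _ = 1 := by
          rw [← Real.exp_add, ← Real.exp_add, ← Real.exp_zero]
          congr 1; ring
  have hx₁0 : 0 < x₁ := by
    rw [hx₁, sub_pos]
    exact Real.log_lt_log (by exact_mod_cast hq₁) (by exact_mod_cast hp₁)
  have hmain := two_logs_interp_inequality (M := κ * L) hKpos'
    (Nat.mul_pos (by omega) hLpos') (by rw [hK]; ring) (by omega) hq₁ (by omega) hq₂ hb₂ hR hS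
    hx₁ hx₂ hx₁0.le hxinj hβ (by exact_mod_cast hbox₁.le)
    (by
      have : (((K - 1) * L : ℕ) : ℝ) < ((R₂ * S₂ : ℕ) : ℝ) := by
        rw [Nat.cast_mul, Nat.cast_sub hKpos']; push_cast; exact hbox₂
      exact_mod_cast this)
    hB hBpos (τ := 1.6) (by norm_num) hg hΛ.le hsmall
  rw [hMr] at hmain
  refine absurd hmain (not_le.2 ?_)
  refine interp_inequality_lt hρ₁ hl₁' hl₂' ha₁ ha₂ ht htsq hh hL1 hL2 hL3 hκ hw0 hw hn0' hn hnt
    hRY hSY hg hB hBpos hb₁ hb ?_ ?_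
  · rw [hx₁, ha₁]
    exact mul_log_sub_add_le (by linarith) hl₁
  · rw [hx₂, ha₂]
    exact mul_log_sub_add_le (by linarith) hl₂

/-- The bound for a linear form of either sign. -/
theorem exp_neg_le_abs_linear_form {p₁ q₁ p₂ q₂ b₁ b₂ : ℕ} {x₁ x₂ l₁ l₂ h : ℝ} (hq₁ : 0 < q₁)
    (hp₁ : q₁ < p₁) (hq₂ : 0 < q₂) (hp₂ : q₂ < p₂) (hb₁ : 0 < b₁) (hb₂ : 0 < b₂)
    (hx₁ : x₁ = Real.log p₁ - Real.log q₁) (hx₂ : x₂ = Real.log p₂ - Real.log q₂)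
    (hl₁ : Real.log p₁ ≤ l₁) (hl₂ : Real.log p₂ ≤ l₂) (hl₁' : 1 ≤ l₁) (hl₂' : 1 ≤ l₂)
    (hindep : ∀ a b : ℤ, a * x₁ = b * x₂ → a = 0 ∧ b = 0) (hh : 10 ≤ h)
    (hb : Real.log (b₁ / l₂ + b₂ / l₁) + 0.38 ≤ h) :
    Real.exp (-(25.2 * (h ^ 2 * l₁ * l₂))) ≤ |b₂ * x₂ - b₁ * x₁| := by
  rcases lt_trichotomy 0 (b₂ * x₂ - b₁ * x₁) with hΛ | hΛ | hΛ
  · rw [abs_of_pos hΛ]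
    exact exp_neg_le_linear_form hq₁ hp₁ hq₂ hp₂ hb₁ hb₂ hx₁ hx₂ hl₁ hl₂ hl₁' hl₂' hindep hh hb hΛ
  · obtain ⟨h0, -⟩ := hindep b₁ b₂ (by push_cast; linarith)
    omega
  · rw [abs_of_neg hΛ, neg_sub, mul_right_comm]
    refine exp_neg_le_linear_form hq₂ hp₂ hq₁ hp₁ hb₂ hb₁ hx₂ hx₁ hl₂ hl₁ hl₂' hl₁'
      (fun a b hab => (hindep b a hab.symm).symm) hh (by rwa [add_comm (b₂ / l₁ : ℝ)]) ?_
    linarith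

/-- A nonzero difference `log p - log q` of logarithms of positive integers is at least
`1 / max p q`. -/
theorem exp_neg_le_log_sub_log {p q : ℕ} {l : ℝ} (hq : 0 < q) (hpq : q < p)
    (hl : Real.log p ≤ l) : Real.exp (-l) ≤ Real.log p - Real.log q := by
  have hq' : (0 : ℝ) < q := by exact_mod_cast hq
  have hp' : (0 : ℝ) < p := by exact_mod_cast hq.trans hpq
  have hpq' : (q : ℝ) + 1 ≤ p := by exact_mod_cast hpq
  have h1 := Real.log_le_sub_one_of_pos (div_pos hq' hp')
  rw [Real.log_div hq'.ne' hp'.ne'] at h1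
  have h2 : Real.exp (-l) ≤ 1 / p := by
    rw [Real.exp_neg, one_div]
    exact inv_anti₀ hp' ((Real.log_le_iff_le_exp hp').1 hl)
  have h3 : 1 / (p : ℝ) ≤ 1 - q / p := by
    rw [le_sub_iff_add_le, ← add_div, div_le_one hp']; linarith
  linarith

/-- A positive rational `α ≠ 1` or its inverse is `p / q` with `q < p`, and the height condition
bounds `log p`. -/
theorem exists_log_eq_log_sub_log {α : ℚ} {l : ℝ} (hα : 0 < α) (hne : Real.log (α : ℝ) ≠ 0)
    (hl : l ≥ max (Real.log (max |(α.num : ℝ)| (α.den : ℝ))) (max |Real.log (α : ℝ)| 1)) :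
    1 ≤ l ∧ ∃ p q : ℕ, 0 < q ∧ q < p ∧ Real.log p ≤ l ∧
      (Real.log α = Real.log p - Real.log q ∨ -Real.log α = Real.log p - Real.log q) := by
  obtain ⟨hl1, hl2⟩ := max_le_iff.1 hl
  refine ⟨(le_max_right _ _).trans hl2, ?_⟩
  obtain ⟨n, hn⟩ := Int.eq_ofNat_of_zero_le (Rat.num_pos.2 hα).le
  have hn0 : 0 < n := by have := Rat.num_pos.2 hα; omega
  have hn0' : (0 : ℝ) < n := by exact_mod_cast hn0
  have hd0' : (0 : ℝ) < α.den := by exact_mod_cast α.den_pos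
  have hnc : (α.num : ℝ) = n := by rw [hn]; simp
  have hx : Real.log α = Real.log n - Real.log α.den := by
    rw [← Real.log_div hn0'.ne' hd0'.ne', ← hnc, Rat.cast_def]
  rw [hnc, Nat.abs_cast] at hl1
  rcases lt_trichotomy n α.den with hlt | heq | hlt
  · refine ⟨α.den, n, hn0, hlt, ?_, Or.inr (by rw [hx]; ring)⟩
    exact (Real.log_le_log hd0' (le_max_right _ _)).trans hl1
  · rw [heq, sub_self] at hx
    exact absurd hx hne
  · refine ⟨n, α.den, α.den_pos, hlt, ?_, Or.inl hx⟩
    exact (Real.log_le_log hn0' (le_max_left _ _)).trans hl1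

/-- Laurent's lower bound for linear forms in two logarithms, rational case (`D = 1`).
Let `α₁, α₂ > 0` be multiplicatively independent rationals, `b₁, b₂` positive integers,
and `A₁, A₂ > 1` reals with `log A_i ≥ max{log H(α_i), |log α_i|, 1}`, where
`H(a/b) = max{|a|, |b|}` in lowest terms.  With `b' = b₁/log A₂ + b₂/log A₁` and
`Λ = b₂·log α₂ − b₁·log α₁`, one has
`log |Λ| ≥ −25.2·(max{log b' + 0.38, 10})²·log A₁·log A₂`. -/
theorem laurent_two_logs (α₁ α₂ : ℚ) (hα₁ : 0 < α₁) (hα₂ : 0 < α₂)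
    (hindep : ∀ a b : ℤ, α₁ ^ a = α₂ ^ b → a = 0 ∧ b = 0)
    (b₁ b₂ : ℕ) (hb₁ : 0 < b₁) (hb₂ : 0 < b₂)
    (A₁ A₂ : ℝ) (hA₁ : 1 < A₁) (hA₂ : 1 < A₂)
    (hlogA₁ : Real.log A₁ ≥
      max (Real.log (max |(α₁.num : ℝ)| (α₁.den : ℝ))) (max |Real.log (α₁ : ℝ)| 1))
    (hlogA₂ : Real.log A₂ ≥
      max (Real.log (max |(α₂.num : ℝ)| (α₂.den : ℝ))) (max |Real.log (α₂ : ℝ)| 1)) :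
    Real.log |(b₂ : ℝ) * Real.log (α₂ : ℝ) - (b₁ : ℝ) * Real.log (α₁ : ℝ)| ≥
      -25.2 * (max (Real.log ((b₁ : ℝ) / Real.log A₂ + (b₂ : ℝ) / Real.log A₁) + 0.38)
          10) ^ 2 * Real.log A₁ * Real.log A₂ := by
  have hlog : ∀ a b : ℤ, a * Real.log α₁ = b * Real.log α₂ → a = 0 ∧ b = 0 := by
    intro a b hab
    rw [← Real.log_zpow, ← Real.log_zpow] at hab
    have hα₁' : (0 : ℝ) < α₁ := by exact_mod_cast hα₁
    have hα₂' : (0 : ℝ) < α₂ := by exact_mod_cast hα₂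
    have := Real.log_injOn_pos (Set.mem_Ioi.2 (zpow_pos hα₁' a)) (Set.mem_Ioi.2 (zpow_pos hα₂' b))
      hab
    exact hindep a b (by exact_mod_cast this)
  have hne₁ : Real.log (α₁ : ℝ) ≠ 0 := fun h0 => by simpa using hlog 1 0 (by simp [h0])
  have hne₂ : Real.log (α₂ : ℝ) ≠ 0 := fun h0 => by simpa using hlog 0 1 (by simp [h0])
  obtain ⟨hl₁, p₁, q₁, hq₁, hp₁, hpl₁, hx₁⟩ := exists_log_eq_log_sub_log hα₁ hne₁ hlogA₁
  obtain ⟨hl₂, p₂, q₂, hq₂, hp₂, hpl₂, hx₂⟩ := exists_log_eq_log_sub_log hα₂ hne₂ hlogA₂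
  obtain ⟨h, hhdef⟩ : ∃ h, h =
    max (Real.log ((b₁ : ℝ) / Real.log A₂ + (b₂ : ℝ) / Real.log A₁) + 0.38) 10 := ⟨_, rfl⟩
  have hh : 10 ≤ h := hhdef ▸ le_max_right _ _
  have hb : Real.log ((b₁ : ℝ) / Real.log A₂ + (b₂ : ℝ) / Real.log A₁) + 0.38 ≤ h :=
    hhdef ▸ le_max_left _ _
  rw [← hhdef]
  generalize Real.log A₁ = l₁ at *
  generalize Real.log A₂ = l₂ at *
  generalize Real.log (α₁ : ℝ) = x₁ at *
  generalize Real.log (α₂ : ℝ) = x₂ at *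
  suffices hexp : Real.exp (-(25.2 * (h ^ 2 * l₁ * l₂))) ≤ |b₂ * x₂ - b₁ * x₁| by
    have := (Real.le_log_iff_exp_le (lt_of_lt_of_le (Real.exp_pos _) hexp)).2 hexp
    linarith
  have hsmall : Real.exp (-(25.2 * (h ^ 2 * l₁ * l₂))) ≤ Real.exp (-l₂) := by
    rw [Real.exp_le_exp, neg_le_neg_iff, ← mul_assoc]
    refine le_mul_of_one_le_left (by linarith) ?_
    have : 1 ≤ h ^ 2 * l₁ := one_le_mul_of_one_le_of_one_le (by nlinarith) hl₁
    linarith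
  have hmixed : ∀ {y₁ y₂ : ℝ}, 0 < y₁ → Real.exp (-l₂) ≤ y₂ →
      Real.exp (-(25.2 * (h ^ 2 * l₁ * l₂))) ≤ b₂ * y₂ + b₁ * y₁ := by
    intro y₁ y₂ hy₁ hy₂
    have e1 : y₂ ≤ b₂ * y₂ :=
      le_mul_of_one_le_left ((Real.exp_pos _).le.trans hy₂) (by exact_mod_cast hb₂)
    have e2 : 0 ≤ b₁ * y₁ := mul_nonneg (Nat.cast_nonneg _) hy₁.le
    linarith
  have hpos₁ := (Real.exp_pos _).trans_le (exp_neg_le_log_sub_log hq₁ hp₁ hpl₁)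
  have hlow₂ := exp_neg_le_log_sub_log hq₂ hp₂ hpl₂
  rcases hx₁ with hx₁ | hx₁ <;> rcases hx₂ with hx₂ | hx₂
  · exact exp_neg_le_abs_linear_form hq₁ hp₁ hq₂ hp₂ hb₁ hb₂ hx₁ hx₂ hpl₁ hpl₂ hl₁ hl₂ hlog hh hb
  · rw [← hx₁] at hpos₁
    rw [← hx₂] at hlow₂
    refine (hmixed hpos₁ hlow₂).trans ((le_of_eq ?_).trans (neg_le_abs _))
    ring
  · rw [← hx₁] at hpos₁
    rw [← hx₂] at hlow₂
    refine (hmixed hpos₁ hlow₂).trans ((le_of_eq ?_).trans (le_abs_self _))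
    ring
  · have := exp_neg_le_abs_linear_form hq₁ hp₁ hq₂ hp₂ hb₁ hb₂ hx₁ hx₂ hpl₁ hpl₂ hl₁ hl₂
      (fun a b hab => hlog a b (by linarith)) hh hb
    rwa [mul_neg, mul_neg, neg_sub_neg, abs_sub_comm] at this
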